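/- arXiv:1004.1520 — 6 statements merged into one kernel-verified Lean document; each statement's English description precedes it below -/
import Mathlib

section
/- Let d ∈ {2, 7, 11, 19, 43, 67, 163}, and for n ≥ 1 let r_d(n) = #{(a,b) ∈ ℤ × ℤ : Q_d(a,b) = n}. Let p be a prime and e ≥ 0 an integer. If p is odd with Legendre symbol (d_K/p) = 1, or p = 2 with d_K ≡ 1 (mod 8), then r_d(p^e) = 2(e+1). If p is odd with (d_K/p) = −1, or p = 2 with d_K ≡ 5 (mod 8), then r_d(p^e) = 1 + (−1)^e. If p divides d_K, then r_d(p^e) = 2. -/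
/-- The norm form `Q_d` of the ring of integers of `ℚ(√−d)` on `ℤ²`:
`a² + d·b²` if `d ≡ 1, 2 (mod 4)`, and `a² + a·b + ((1+d)/4)·b²` if `d ≡ 3 (mod 4)`. -/
def Qf (d : ℕ) (p : ℤ × ℤ) : ℤ :=
  if d % 4 = 3 then p.1 ^ 2 + p.1 * p.2 + (((1 + d) / 4 : ℕ) : ℤ) * p.2 ^ 2
  else p.1 ^ 2 + (d : ℤ) * p.2 ^ 2

/-- The discriminant `d_K` of `ℚ(√−d)` for a squarefree positive integer `d`:
`−4d` if `d ≡ 1, 2 (mod 4)` and `−d` if `d ≡ 3 (mod 4)`. -/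
def discK (d : ℕ) : ℤ := if d % 4 = 3 then -(d : ℤ) else -4 * (d : ℤ)

/-- The number of lattice points of norm `n`: `r_d(n) = #{(a,b) ∈ ℤ × ℤ : Q_d(a,b) = n}`. -/
noncomputable def rShell (d n : ℕ) : ℕ := Nat.card {p : ℤ × ℤ // Qf d p = (n : ℤ)}

namespace Shell7

abbrev RR (t m : ℤ) := QuadraticAlgebra ℤ (-m) t

theorem nm {t m : ℤ} (z : RR t m) :
    z.norm = z.re ^ 2 + t * z.re * z.im + m * z.im ^ 2 := by
  rw [QuadraticAlgebra.norm_def]; ring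

/-- admissible parameters -/
def Adm (t m : ℤ) : Prop :=
  (t = 0 ∧ m = 2) ∨ (t = 1 ∧ (m = 2 ∨ m = 3 ∨ m = 5 ∨ m = 11 ∨ m = 17 ∨ m = 41))

theorem Adm.disc {t m : ℤ} (h : Adm t m) : 7 ≤ 4 * m - t ^ 2 := by
  rcases h with ⟨rfl, rfl⟩ | ⟨rfl, h⟩
  · norm_num
  · omega

theorem reduced {t m A B C : ℤ} (h : Adm t m) (hA : 0 < A) (hB : |B| ≤ A) (hC : A ≤ C)
    (hD : B ^ 2 - 4 * A * C = t ^ 2 - 4 * m) : A = 1 := by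
  obtain ⟨h1, h2⟩ := abs_le.mp hB
  have hb : B ^ 2 ≤ A ^ 2 := sq_le_sq' h1 h2
  have hm : m ≤ 41 := by rcases h with ⟨rfl, rfl⟩ | ⟨rfl, h⟩ <;> omega
  have h7 : A ≤ 7 := by nlinarith [sq_nonneg t]
  clear hb hB hm
  rcases h with ⟨rfl, rfl⟩ | ⟨rfl, rfl | rfl | rfl | rfl | rfl | rfl⟩ <;>
  interval_cases A <;> first | rfl | (exfalso; interval_cases B <;> omega)

theorem descent {t m : ℤ} (h : Adm t m) (n : ℕ) : ∀ A B C : ℤ, 0 < A → A.toNat = n →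
    B ^ 2 - 4 * A * C = t ^ 2 - 4 * m →
    ∃ a b c d : ℤ, ∀ x y : ℤ, A * x ^ 2 + B * x * y + C * y ^ 2 =
      (a * x + b * y) ^ 2 + t * (a * x + b * y) * (c * x + d * y) + m * (c * x + d * y) ^ 2 := by
  induction n using Nat.strong_induction_on with
  | _ n ih =>
    intro A B C hA hn hD
    obtain ⟨k, hk⟩ : ∃ k : ℤ, |B - 2 * A * k| ≤ A := by
      refine ⟨(B + A) / (2 * A), ?_⟩
      have e1 := Int.emod_add_mul_ediv (B + A) (2 * A)
      have e2 := Int.emod_nonneg (B + A) (show 2 * A ≠ 0 by omega)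
      have e3 := Int.emod_lt_of_pos (B + A) (show 0 < 2 * A by omega)
      rw [abs_le]; constructor <;> linarith
    obtain ⟨B', hB'⟩ : ∃ B', B' = B - 2 * A * k := ⟨_, rfl⟩
    obtain ⟨C', hC'⟩ : ∃ C', C' = C - B * k + A * k ^ 2 := ⟨_, rfl⟩
    rw [← hB'] at hk
    have hD' : B' ^ 2 - 4 * A * C' = t ^ 2 - 4 * m := by
      rw [← hD, hB', hC']; ring
    have hdisc := h.disc
    suffices H : ∃ a b c d : ℤ, ∀ x y : ℤ, A * x ^ 2 + B' * x * y + C' * y ^ 2 =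
      (a * x + b * y) ^ 2 + t * (a * x + b * y) * (c * x + d * y) + m * (c * x + d * y) ^ 2 by
      obtain ⟨a, b, c, d, H⟩ := H
      refine ⟨a, a * k + b, c, c * k + d, fun x y => ?_⟩
      have := H (x + k * y) y
      rw [hB', hC'] at this
      linear_combination this
    by_cases hc : A ≤ C'
    · have h1 := reduced h hA hk hc hD'
      subst h1
      obtain ⟨g1, g2⟩ := abs_le.mp hk
      have ht : t = 0 ∨ t = 1 := by rcases h with ⟨rfl, _⟩ | ⟨rfl, _⟩ <;> simp
      have key : B' = t ∨ B' = - t := by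
        rcases ht with rfl | rfl
        · have : B' = -1 ∨ B' = 0 ∨ B' = 1 := by omega
          rcases this with rfl | rfl | rfl <;> omega
        · have : B' = -1 ∨ B' = 0 ∨ B' = 1 := by omega
          rcases this with rfl | rfl | rfl <;> omega
      have hCm : C' = m := by
        rcases key with rfl | rfl <;> linarith
      subst hCm
      rcases key with rfl | rfl
      · exact ⟨1, 0, 0, 1, fun x y => by ring⟩
      · exact ⟨1, 0, 0, -1, fun x y => by ring⟩
    · have hcpos : 0 < C' := by nlinarith [sq_nonneg B']
      obtain ⟨a, b, c, d, H⟩ := ih C'.toNat (by omega) C' (-B') A hcpos rfl (by rw [← hD']; ring)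
      refine ⟨-b, a, -d, c, fun x y => ?_⟩
      have := H y (-x)
      linear_combination this

theorem exists_norm {t m : ℤ} (h : Adm t m) (p : ℕ) (hp : p.Prime) (r : ℤ)
    (hr : (p : ℤ) ∣ r ^ 2 + t * r + m) : ∃ π : RR t m, π.norm = p := by
  obtain ⟨C, hC⟩ := hr
  obtain ⟨a, b, c, d, H⟩ := descent h _ (p : ℤ) (2 * r + t) C (by exact_mod_cast hp.pos) rfl
    (by linear_combination 4 * hC)
  refine ⟨⟨a, c⟩, ?_⟩
  rw [nm]
  have := H 1 0
  simp at this
  simp [this]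

theorem units {t m : ℤ} (h : Adm t m) (z : RR t m) (hz : z.norm = 1) : z = 1 ∨ z = -1 := by
  rw [nm] at hz
  have hd := h.disc
  have h0 : z.im = 0 := by
    by_contra h0
    have : 1 ≤ z.im ^ 2 := by have := sq_nonneg z.im; have : z.im ^ 2 ≠ 0 := pow_ne_zero _ h0; omega
    nlinarith [sq_nonneg (2 * z.re + t * z.im)]
  rw [h0] at hz
  have : z.re = 1 ∨ z.re = -1 := by
    exact sq_eq_one_iff.mp (by linarith)
  rcases this with h1 | h1
  · left; ext <;> simp [h0, h1, QuadraticAlgebra.re_one, QuadraticAlgebra.im_one]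
  · right; ext <;> simp [h0, h1, QuadraticAlgebra.re_one, QuadraticAlgebra.im_one]

theorem norm_pos {t m : ℤ} (h : Adm t m) (z : RR t m) (hz : z ≠ 0) : z.norm ≠ 0 := by
  intro h1
  apply hz
  rw [nm] at h1
  have hd := h.disc
  have h0 : z.im = 0 := by
    by_contra h0
    have : 1 ≤ z.im ^ 2 := by have := sq_nonneg z.im; have : z.im ^ 2 ≠ 0 := pow_ne_zero _ h0; omega
    nlinarith [sq_nonneg (2 * z.re + t * z.im)]
  rw [h0] at h1
  have : z.re = 0 := by
    have : z.re ^ 2 = 0 := by linarith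
    exact pow_eq_zero_iff (two_ne_zero) |>.mp this
  ext <;> simp [h0, this]

theorem noZD {t m : ℤ} (h : Adm t m) : NoZeroDivisors (RR t m) := by
  constructor
  intro a b hab
  by_contra! hc
  have := congrArg QuadraticAlgebra.norm hab
  rw [map_mul, QuadraticAlgebra.norm_zero] at this
  exact mul_ne_zero (norm_pos h a hc.1) (norm_pos h b hc.2) this

/-- if `p ∣ im` and `p ∣ norm` then `p` divides -/
theorem p_dvd {t m : ℤ} (p : ℕ) (hp : p.Prime) (z : RR t m)
    (h1 : (p : ℤ) ∣ z.im) (h2 : (p : ℤ) ∣ z.norm) : ∃ w : RR t m, z = (p : RR t m) * w := by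
  rw [nm] at h2
  have h3 : (p : ℤ) ∣ z.re := by
    apply (Nat.prime_iff_prime_int.mp hp).dvd_of_dvd_pow (n := 2)
    obtain ⟨k, hk⟩ := h1
    obtain ⟨l, hl⟩ := h2
    rw [hk] at hl
    exact ⟨l - t * z.re * k - m * p * k ^ 2, by linear_combination hl⟩
  obtain ⟨k, hk⟩ := h1
  obtain ⟨l, hl⟩ := h3
  exact ⟨⟨l, k⟩, by ext <;> simp [hk, hl]⟩

theorem mulstar {t m : ℤ} {p : ℕ} {π : RR t m} (hπ : π.norm = p) : π * star π = (p : RR t m) := by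
  rw [← QuadraticAlgebra.algebraMap_norm_eq_mul_star, hπ]; simp

theorem im_ndvd {t m : ℤ} {p : ℕ} (hp : p.Prime) {π : RR t m} (hπ : π.norm = p) :
    ¬ (p : ℤ) ∣ π.im := by
  intro h
  obtain ⟨w, hw⟩ := p_dvd p hp π h (by rw [hπ])
  have := congrArg QuadraticAlgebra.norm hw
  rw [hπ, map_mul, QuadraticAlgebra.norm_natCast] at this
  have hp0 : (p : ℤ) ≠ 0 := by exact_mod_cast hp.ne_zero
  have h1 : (p : ℤ) * w.norm = 1 := by
    apply mul_left_cancel₀ hp0; linear_combination -this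
  have := Int.isUnit_iff.mp (IsUnit.of_mul_eq_one _ h1)
  have := hp.two_le
  omega

theorem half {t m : ℤ} (h : Adm t m) {p : ℕ} (hp : p.Prime) {π : RR t m} (hπ : π.norm = p)
    (z : RR t m) (hz : (p : ℤ) ∣ z.norm) (hd : (p : ℤ) ∣ (star π * z).im) : π ∣ z := by
  have := noZD h
  obtain ⟨w, hw⟩ := p_dvd p hp _ hd (by rw [map_mul]; exact hz.mul_left _)
  refine ⟨w, ?_⟩
  have hs : star π ≠ 0 := by
    intro h0
    have := QuadraticAlgebra.norm_star π
    rw [h0, hπ, QuadraticAlgebra.norm_zero] at this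
    exact hp.ne_zero (by exact_mod_cast this.symm)
  apply mul_left_cancel₀ hs
  rw [hw, ← mulstar hπ]; ring

theorem dvd_or {t m : ℤ} (h : Adm t m) {p : ℕ} (hp : p.Prime) {π : RR t m} (hπ : π.norm = p)
    (z : RR t m) (hz : (p : ℤ) ∣ z.norm) : π ∣ z ∨ star π ∣ z := by
  have key : (p : ℤ) ∣ (star π * z).im * (star (star π) * z).im := by
    obtain ⟨k, hk⟩ := hz
    rw [nm] at hk hπ
    simp
    exact ⟨z.im ^ 2 - π.im ^ 2 * k, by linear_combination z.im ^ 2 * hπ - π.im ^ 2 * hk⟩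
  rcases (Nat.prime_iff_prime_int.mp hp).dvd_or_dvd key with h1 | h1
  · exact .inl (half h hp hπ z hz h1)
  · exact .inr (half h hp (by rw [QuadraticAlgebra.norm_star, hπ]) z hz h1)

theorem classify {t m : ℤ} (h : Adm t m) {p : ℕ} (hp : p.Prime) {π : RR t m} (hπ : π.norm = p)
    (e : ℕ) : ∀ z : RR t m, z.norm = (p : ℤ) ^ e →
      ∃ u : ℤˣ, ∃ i j : ℕ, i + j = e ∧ z = ((u : ℤ) : RR t m) * π ^ i * star π ^ j := by
  have hp0 : (p : ℤ) ≠ 0 := by exact_mod_cast hp.ne_zero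
  induction e with
  | zero =>
    intro z hz
    rcases units h z (by simpa using hz) with rfl | rfl
    · exact ⟨1, 0, 0, rfl, by simp⟩
    · exact ⟨-1, 0, 0, rfl, by simp⟩
  | succ e ih =>
    intro z hz
    rcases dvd_or h hp hπ z (by rw [hz]; exact dvd_pow_self _ (by omega)) with ⟨w, hw⟩ | ⟨w, hw⟩
    · obtain ⟨u, i, j, hij, rfl⟩ := ih w (by
        rw [hw, map_mul, hπ] at hz
        apply mul_left_cancel₀ hp0; rw [hz]; ring)
      exact ⟨u, i + 1, j, by omega, by rw [hw]; ring⟩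
    · obtain ⟨u, i, j, hij, rfl⟩ := ih w (by
        rw [hw, map_mul, QuadraticAlgebra.norm_star, hπ] at hz
        apply mul_left_cancel₀ hp0; rw [hz]; ring)
      exact ⟨u, i, j + 1, by omega, by rw [hw]; ring⟩

theorem norm_unit {t m : ℤ} (u : ℤˣ) : ((u : ℤ) : RR t m).norm = 1 := by
  rcases Int.units_eq_one_or u with rfl | rfl <;> simp

theorem pow_mod {t m : ℤ} {p : ℕ} {π : RR t m} (hπ : π.norm = p) (n : ℕ) :
    ∃ w : RR t m, π ^ (n + 1) = (((2 * π.re + t * π.im) ^ n : ℤ) : RR t m) * π + (p : RR t m) * w := by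
  induction n with
  | zero => exact ⟨0, by simp⟩
  | succ n ih =>
    obtain ⟨w, hw⟩ := ih
    have hs : π ^ 2 = ((2 * π.re + t * π.im : ℤ) : RR t m) * π - (p : RR t m) := by
      have h2 : ((2 * π.re + t * π.im : ℤ) : RR t m) = π + star π := by
        ext
        · simp only [QuadraticAlgebra.re_intCast, QuadraticAlgebra.re_add, QuadraticAlgebra.re_star]
          simp; ring
        · simp only [QuadraticAlgebra.im_intCast, QuadraticAlgebra.im_add, QuadraticAlgebra.im_star]
          ring
      rw [← mulstar hπ, h2]; ring
    refine ⟨π * w - (((2 * π.re + t * π.im) ^ n : ℤ) : RR t m), ?_⟩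
    rw [pow_succ, hw]
    push_cast at hs ⊢
    linear_combination ((2 : RR t m) * (π.re : RR t m) + (t : RR t m) * (π.im : RR t m)) ^ n * hs

theorem T_ndvd {t m : ℤ} {p : ℕ} (hp : p.Prime) {π : RR t m} (hπ : π.norm = p)
    (hD : ¬ (p : ℤ) ∣ t ^ 2 - 4 * m) : ¬ (p : ℤ) ∣ 2 * π.re + t * π.im := by
  rintro ⟨k, hk⟩
  have hP := Nat.prime_iff_prime_int.mp hp
  have h1 : (p : ℤ) ∣ (t ^ 2 - 4 * m) * π.im ^ 2 := by
    rw [nm] at hπ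
    exact ⟨p * k ^ 2 - 4, by linear_combination (-4) * hπ + (2 * π.re + t * π.im + p * k) * hk⟩
  rcases hP.dvd_or_dvd h1 with h | h
  · exact hD h
  · exact im_ndvd hp hπ (hP.dvd_of_dvd_pow h)

theorem pow_ne {t m : ℤ} {p : ℕ} (hp : p.Prime) {π : RR t m} (hπ : π.norm = p)
    (hD : ¬ (p : ℤ) ∣ t ^ 2 - 4 * m) (n : ℕ) (u : ℤˣ) :
    π ^ (n + 1) ≠ ((u : ℤ) : RR t m) * star π ^ (n + 1) := by
  intro heq
  have hP := Nat.prime_iff_prime_int.mp hp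
  have hT := T_ndvd hp hπ hD
  have hTn : ¬ (p : ℤ) ∣ (2 * π.re + t * π.im) ^ n := fun h => hT (hP.dvd_of_dvd_pow h)
  obtain ⟨w, hw⟩ := pow_mod hπ n
  rw [← star_pow] at heq
  have hre := congrArg QuadraticAlgebra.re hw
  have him := congrArg QuadraticAlgebra.im hw
  generalize (2 * π.re + t * π.im) ^ n = T at *
  generalize π ^ (n + 1) = q at *
  have h1 := congrArg QuadraticAlgebra.re heq
  have h2 := congrArg QuadraticAlgebra.im heq
  rcases Int.units_eq_one_or u with rfl | rfl
  · simp at h1 h2 hre him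
    have h3 : q.im = 0 := by omega
    have : (p : ℤ) ∣ T * π.im := ⟨-w.im, by linear_combination h3 - him⟩
    rcases hP.dvd_or_dvd this with h | h
    · exact hTn h
    · exact im_ndvd hp hπ h
  · simp at h1 h2 hre him
    have : (p : ℤ) ∣ T * (2 * π.re + t * π.im) :=
      ⟨-2 * w.re - t * w.im, by linear_combination h1 - 2 * hre - t * him⟩
    rcases hP.dvd_or_dvd this with h | h
    · exact hTn h
    · exact hT h

theorem inj_aux {t m : ℤ} (h : Adm t m) {p : ℕ} (hp : p.Prime) {π : RR t m} (hπ : π.norm = p)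
    (hD : ¬ (p : ℤ) ∣ t ^ 2 - 4 * m) (e i k : ℕ) (hik : i < k) (hk : k ≤ e) (u v : ℤˣ)
    (heq : ((u : ℤ) : RR t m) * π ^ i * star π ^ (e - i) =
      ((v : ℤ) : RR t m) * π ^ k * star π ^ (e - k)) : False := by
  have := noZD h
  have hπ0 : π ≠ 0 := by
    rintro rfl
    rw [QuadraticAlgebra.norm_zero] at hπ
    exact hp.ne_zero (by exact_mod_cast hπ.symm)
  have hs0 : star π ≠ 0 := by simpa using hπ0
  obtain ⟨n, rfl⟩ : ∃ n, k = i + (n + 1) := ⟨k - i - 1, by omega⟩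
  obtain ⟨j, rfl⟩ : ∃ j, e = i + (n + 1) + j := ⟨e - (i + (n + 1)), by omega⟩
  rw [show i + (n + 1) + j - i = (n + 1) + j by omega,
    show i + (n + 1) + j - (i + (n + 1)) = j by omega] at heq
  have h1 : ((u : ℤ) : RR t m) * star π ^ (n + 1) = ((v : ℤ) : RR t m) * π ^ (n + 1) := by
    apply mul_left_cancel₀ (mul_ne_zero (pow_ne_zero i hπ0) (pow_ne_zero j hs0))
    linear_combination heq
  apply pow_ne hp hπ hD n (v * u)
  have hv : ((v : ℤ) : RR t m) * ((v : ℤ) : RR t m) = 1 := by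
    rcases Int.units_eq_one_or v with rfl | rfl <;> simp
  push_cast
  linear_combination (-(v : ℤ) : RR t m) * h1 - π ^ (n + 1) * hv

theorem norm_el {t m : ℤ} {p : ℕ} {π : RR t m} (hπ : π.norm = p) (u : ℤˣ) (i j : ℕ) :
    (((u : ℤ) : RR t m) * π ^ i * star π ^ j).norm = (p : ℤ) ^ (i + j) := by
  rw [map_mul, map_mul, map_pow, map_pow, QuadraticAlgebra.norm_star, hπ, norm_unit]; ring

theorem unit_inj {t m : ℤ} (h : Adm t m) (u v : ℤˣ) (z : RR t m) (hz : z ≠ 0)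
    (heq : ((u : ℤ) : RR t m) * z = ((v : ℤ) : RR t m) * z) : u = v := by
  have := noZD h
  have := mul_right_cancel₀ hz heq
  exact Units.ext (by exact_mod_cast this)

theorem card_split {t m : ℤ} (h : Adm t m) {p : ℕ} (hp : p.Prime) {π : RR t m} (hπ : π.norm = p)
    (hD : ¬ (p : ℤ) ∣ t ^ 2 - 4 * m) (e : ℕ) :
    Nat.card {z : RR t m // z.norm = (p : ℤ) ^ e} = 2 * (e + 1) := by
  let f : ℤˣ × Fin (e + 1) → {z : RR t m // z.norm = (p : ℤ) ^ e} := fun x =>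
    ⟨((x.1 : ℤ) : RR t m) * π ^ (x.2 : ℕ) * star π ^ (e - (x.2 : ℕ)), by
      rw [norm_el hπ]; congr 1; omega⟩
  have hf : Function.Bijective f := by
    constructor
    · rintro ⟨u, i, hi⟩ ⟨v, k, hk⟩ heq
      have heq : ((u : ℤ) : RR t m) * π ^ i * star π ^ (e - i) =
        ((v : ℤ) : RR t m) * π ^ k * star π ^ (e - k) := congrArg Subtype.val heq
      rcases lt_trichotomy i k with hik | rfl | hik
      · exact (inj_aux h hp hπ hD e i k hik (by omega) u v heq).elim
      · rw [mul_assoc, mul_assoc] at heq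
        have := unit_inj h u v _ (by
          intro h0
          have := norm_el hπ 1 i (e - i)
          rw [mul_assoc, h0, mul_zero, QuadraticAlgebra.norm_zero] at this
          exact pow_ne_zero _ (by exact_mod_cast hp.ne_zero) this.symm) heq
        rw [this]
      · exact (inj_aux h hp hπ hD e k i hik (by omega) v u heq.symm).elim
    · rintro ⟨z, hz⟩
      obtain ⟨u, i, j, hij, rfl⟩ := classify h hp hπ e z hz
      refine ⟨⟨u, i, by omega⟩, ?_⟩
      apply Subtype.ext
      simp only [f]
      rw [show e - i = j by omega]
  rw [← Nat.card_congr (Equiv.ofBijective f hf), Nat.card_prod]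
  simp

theorem card_ram {t m : ℤ} (h : Adm t m) {p : ℕ} (hp : p.Prime) {π : RR t m} (hπ : π.norm = p)
    (hs : star π = -π) (e : ℕ) :
    Nat.card {z : RR t m // z.norm = (p : ℤ) ^ e} = 2 := by
  let f : ℤˣ → {z : RR t m // z.norm = (p : ℤ) ^ e} := fun u =>
    ⟨((u : ℤ) : RR t m) * π ^ e, by
      have := norm_el hπ u e 0
      simpa using this⟩
  have hf : Function.Bijective f := by
    constructor
    · intro u v heq
      have heq : ((u : ℤ) : RR t m) * π ^ e = ((v : ℤ) : RR t m) * π ^ e := congrArg Subtype.val heq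
      refine unit_inj h u v _ ?_ heq
      intro h0
      have := norm_el hπ 1 e 0
      rw [pow_zero, mul_one, h0, mul_zero, QuadraticAlgebra.norm_zero] at this
      exact pow_ne_zero _ (by exact_mod_cast hp.ne_zero) this.symm
    · rintro ⟨z, hz⟩
      obtain ⟨u, i, j, hij, rfl⟩ := classify h hp hπ e z hz
      refine ⟨u * (-1) ^ j, ?_⟩
      apply Subtype.ext
      simp only [f]
      rw [hs, neg_pow π, ← hij, pow_add]
      push_cast
      ring
  rw [← Nat.card_congr (Equiv.ofBijective f hf)]
  simp

theorem inert_dvd {t m : ℤ} {p : ℕ} (hp : p.Prime)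
    (hr : ∀ r : ℤ, ¬ (p : ℤ) ∣ r ^ 2 + t * r + m) (z : RR t m) (hz : (p : ℤ) ∣ z.norm) :
    ∃ w : RR t m, z = (p : RR t m) * w := by
  apply p_dvd p hp z _ hz
  by_contra hv
  have hcop : IsCoprime z.im (p : ℤ) :=
    ((Nat.prime_iff_prime_int.mp hp).coprime_iff_not_dvd.mpr hv).symm
  obtain ⟨a, b, hab⟩ := hcop
  obtain ⟨k, hk⟩ := hz
  rw [nm] at hk
  apply hr (z.re * a)
  refine ⟨a ^ 2 * k + t * z.re * a * b + m * b * (1 + a * z.im), ?_⟩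
  linear_combination a ^ 2 * hk - (t * z.re * a + m * (1 + a * z.im)) * hab

theorem card_inert {t m : ℤ} (h : Adm t m) {p : ℕ} (hp : p.Prime)
    (hr : ∀ r : ℤ, ¬ (p : ℤ) ∣ r ^ 2 + t * r + m) (e : ℕ) :
    (Nat.card {z : RR t m // z.norm = (p : ℤ) ^ e} : ℤ) = 1 + (-1) ^ e := by
  have hp0 : (p : ℤ) ≠ 0 := by exact_mod_cast hp.ne_zero
  have := noZD h
  induction e using Nat.twoStepInduction with
  | zero =>
    let f : ℤˣ → {z : RR t m // z.norm = (p : ℤ) ^ 0} := fun u =>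
      ⟨((u : ℤ) : RR t m), by rw [norm_unit]; simp⟩
    have hf : Function.Bijective f := by
      constructor
      · intro u v heq
        have heq : ((u : ℤ) : RR t m) = ((v : ℤ) : RR t m) := congrArg Subtype.val heq
        exact Units.ext (by exact_mod_cast heq)
      · rintro ⟨z, hz⟩
        rcases units h z (by simpa using hz) with rfl | rfl
        · exact ⟨1, Subtype.ext (by simp [f])⟩
        · exact ⟨-1, Subtype.ext (by simp [f])⟩
    rw [← Nat.card_congr (Equiv.ofBijective f hf)]
    simp
  | one =>
    have : IsEmpty {z : RR t m // z.norm = (p : ℤ) ^ 1} := by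
      constructor
      rintro ⟨z, hz⟩
      obtain ⟨w, hw⟩ := inert_dvd hp hr z (by rw [hz, pow_one])
      rw [pow_one] at hz
      apply im_ndvd hp hz
      exact ⟨w.im, by rw [hw]; simp⟩
    rw [Nat.card_of_isEmpty]; simp
  | more e ih _ =>
    let f : {z : RR t m // z.norm = (p : ℤ) ^ e} → {z : RR t m // z.norm = (p : ℤ) ^ (e + 2)} :=
      fun z => ⟨(p : RR t m) * z.1, by
        rw [map_mul, QuadraticAlgebra.norm_natCast, z.2]; ring⟩
    have hf : Function.Bijective f := by
      constructor
      · intro u v heq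
        have heq : (p : RR t m) * u.1 = (p : RR t m) * v.1 := congrArg Subtype.val heq
        exact Subtype.ext (mul_left_cancel₀ (by exact_mod_cast hp.ne_zero) heq)
      · rintro ⟨z, hz⟩
        obtain ⟨w, rfl⟩ := inert_dvd hp hr z (by rw [hz]; exact dvd_pow_self _ (by omega))
        refine ⟨⟨w, ?_⟩, rfl⟩
        rw [map_mul, QuadraticAlgebra.norm_natCast] at hz
        apply mul_left_cancel₀ (pow_ne_zero 2 hp0)
        rw [hz]; ring
    rw [← Nat.card_congr (Equiv.ofBijective f hf), ih]
    ring

theorem rShell_eq (d : ℕ) (t m : ℤ) (hQ : ∀ a b : ℤ, Qf d (a, b) = a ^ 2 + t * a * b + m * b ^ 2)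
    (p e : ℕ) : rShell d (p ^ e) = Nat.card {z : RR t m // z.norm = (p : ℤ) ^ e} := by
  unfold rShell
  apply Nat.card_congr
  refine ((QuadraticAlgebra.equivProd (-m) t).subtypeEquiv ?_).symm
  intro z
  rw [nm, show QuadraticAlgebra.equivProd (-m) t z = (z.re, z.im) from rfl, hQ]
  push_cast
  rfl

/-- root of the polynomial from a square root of the discriminant -/
theorem root_iff {t m : ℤ} (p : ℕ) [hp : Fact p.Prime] (h2 : p ≠ 2) :
    (∃ r : ℤ, (p : ℤ) ∣ r ^ 2 + t * r + m) ↔ IsSquare ((t ^ 2 - 4 * m : ℤ) : ZMod p) := by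
  have h20 : (2 : ZMod p) ≠ 0 := by
    intro h
    have : ((2 : ℕ) : ZMod p) = 0 := by exact_mod_cast h
    rw [ZMod.natCast_eq_zero_iff] at this
    exact h2 ((Nat.prime_dvd_prime_iff_eq hp.out Nat.prime_two).mp this)
  constructor
  · rintro ⟨r, hr⟩
    have h0 := (ZMod.intCast_zmod_eq_zero_iff_dvd _ p).mpr hr
    push_cast at h0
    refine ⟨2 * r + t, ?_⟩
    push_cast
    linear_combination (-4) * h0
  · rintro ⟨s, hs⟩
    obtain ⟨r, hr⟩ := ZMod.intCast_surjective ((s - t) / 2 : ZMod p)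
    refine ⟨r, (ZMod.intCast_zmod_eq_zero_iff_dvd _ p).mp ?_⟩
    have hr2 : 2 * (r : ZMod p) = s - t := by rw [hr]; field_simp
    push_cast at hs ⊢
    have h4 : (2 : ZMod p) * 2 * (r ^ 2 + t * r + m) = 0 := by
      linear_combination (2 * (r : ZMod p) + t + s) * hr2 - hs
    rcases mul_eq_zero.mp h4 with h | h
    · exact absurd h (mul_ne_zero h20 h20)
    · exact h

theorem main (d : ℕ) (t m : ℤ) (h : Adm t m)
    (hQ : ∀ a b : ℤ, Qf d (a, b) = a ^ 2 + t * a * b + m * b ^ 2)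
    (hK : discK d = t ^ 2 - 4 * m)
    (hram : ∀ p : ℕ, p.Prime → (p : ℤ) ∣ t ^ 2 - 4 * m → ∃ π : RR t m, π.norm = p ∧ star π = -π)
    (p : ℕ) [hp : Fact p.Prime] (e : ℕ) :
    (((p ≠ 2 ∧ legendreSym p (discK d) = 1) ∨ (p = 2 ∧ discK d % 8 = 1)) →
      rShell d (p ^ e) = 2 * (e + 1)) ∧
    (((p ≠ 2 ∧ legendreSym p (discK d) = -1) ∨ (p = 2 ∧ discK d % 8 = 5)) →
      (rShell d (p ^ e) : ℤ) = 1 + (-1) ^ e) ∧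
    ((p : ℤ) ∣ discK d → rShell d (p ^ e) = 2) := by
  rw [rShell_eq d t m hQ, hK]
  have ht : t = 0 ∨ t = 1 := by rcases h with ⟨rfl, _⟩ | ⟨rfl, _⟩ <;> simp
  refine ⟨?_, ?_, ?_⟩
  · rintro (⟨h2, hl⟩ | ⟨rfl, hl⟩)
    · have hD0 : ((t ^ 2 - 4 * m : ℤ) : ZMod p) ≠ 0 := by
        intro h0
        rw [(legendreSym.eq_zero_iff p _).mpr h0] at hl
        omega
      obtain ⟨r, hr⟩ := (root_iff p h2).mpr ((legendreSym.eq_one_iff p hD0).mp hl)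
      obtain ⟨π, hπ⟩ := exists_norm h p hp.out r hr
      exact card_split h hp.out hπ
        (fun hd => hD0 ((ZMod.intCast_zmod_eq_zero_iff_dvd _ p).mpr hd)) e
    · obtain ⟨π, hπ⟩ := exists_norm h 2 hp.out 0 (by
        rcases ht with rfl | rfl <;> push_cast <;> omega)
      exact card_split h hp.out hπ (by push_cast; omega) e
  · rintro (⟨h2, hl⟩ | ⟨rfl, hl⟩)
    · refine card_inert h hp.out ?_ e
      intro r hr
      exact (legendreSym.eq_neg_one_iff p).mp hl ((root_iff p h2).mp ⟨r, hr⟩)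
    · refine card_inert h hp.out ?_ e
      intro r hr
      have ht1 : t = 1 := by rcases ht with rfl | rfl <;> omega
      subst ht1
      have := Int.even_mul_succ_self r
      obtain ⟨k, hk⟩ := this
      have : r ^ 2 + 1 * r = k + k := by rw [← hk]; ring
      rw [this] at hr
      push_cast at hr
      omega
  · intro hd
    obtain ⟨π, hπ, hs⟩ := hram p hp.out hd
    exact card_ram h hp.out hπ hs e

theorem main1 (d : ℕ) (m : ℤ) (h : Adm 1 m) (hd : d % 4 = 3) (hdm : 4 * m = d + 1)
    (hpr : d.Prime) (p : ℕ) [hp : Fact p.Prime] (e : ℕ) :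
    (((p ≠ 2 ∧ legendreSym p (discK d) = 1) ∨ (p = 2 ∧ discK d % 8 = 1)) →
      rShell d (p ^ e) = 2 * (e + 1)) ∧
    (((p ≠ 2 ∧ legendreSym p (discK d) = -1) ∨ (p = 2 ∧ discK d % 8 = 5)) →
      (rShell d (p ^ e) : ℤ) = 1 + (-1) ^ e) ∧
    ((p : ℤ) ∣ discK d → rShell d (p ^ e) = 2) := by
  apply main d 1 m h
  · intro a b
    have : (((1 + d) / 4 : ℕ) : ℤ) = m := by omega
    simp only [Qf, hd, if_true, this]
    ring
  · simp only [discK, hd, if_true]; omega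
  · intro q hq hqd
    have : (q : ℤ) ∣ d := by
      rw [show (1 : ℤ) ^ 2 - 4 * m = -d by omega] at hqd
      exact (dvd_neg.mp hqd)
    have : q = d := (Nat.prime_dvd_prime_iff_eq hq hpr).mp (by exact_mod_cast this)
    subst this
    refine ⟨⟨-1, 2⟩, ?_, ?_⟩
    · rw [nm]; simp; linarith
    · ext <;> simp

end Shell7

/-- For `d ∈ {2, 7, 11, 19, 43, 67, 163}`, a prime `p` and `e ≥ 0`:
`r_d(p^e) = 2(e+1)` if `p` is odd with `(d_K/p) = 1` or `p = 2` with `d_K ≡ 1 (mod 8)`;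
`r_d(p^e) = 1 + (−1)^e` if `p` is odd with `(d_K/p) = −1` or `p = 2` with `d_K ≡ 5 (mod 8)`;
and `r_d(p^e) = 2` if `p ∣ d_K`. -/
theorem stmt_7 (d : ℕ) (hd : d ∈ ({2, 7, 11, 19, 43, 67, 163} : Finset ℕ))
    (p : ℕ) [hp : Fact p.Prime] (e : ℕ) :
    (((p ≠ 2 ∧ legendreSym p (discK d) = 1) ∨ (p = 2 ∧ discK d % 8 = 1)) →
      rShell d (p ^ e) = 2 * (e + 1)) ∧
    (((p ≠ 2 ∧ legendreSym p (discK d) = -1) ∨ (p = 2 ∧ discK d % 8 = 5)) →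
      (rShell d (p ^ e) : ℤ) = 1 + (-1) ^ e) ∧
    ((p : ℤ) ∣ discK d → rShell d (p ^ e) = 2) := by

  simp only [Finset.mem_insert, Finset.mem_singleton] at hd
  rcases hd with rfl | rfl | rfl | rfl | rfl | rfl | rfl
  · apply Shell7.main 2 0 2 (by simp [Shell7.Adm])
    · intro a b; simp [Qf]
    · simp [discK]
    · intro q hq hqd
      have : q ∣ 2 ^ 3 := by
        have : (q : ℤ) ∣ ((2 ^ 3 : ℕ) : ℤ) := by
          have h := dvd_neg.mpr hqd
          norm_num at h ⊢
          exact h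
        exact_mod_cast this
      have := (Nat.prime_dvd_prime_iff_eq hq Nat.prime_two).mp (hq.dvd_of_dvd_pow this)
      subst this
      refine ⟨⟨0, 1⟩, ?_, ?_⟩
      · rw [Shell7.nm]; simp
      · ext <;> simp
  · exact Shell7.main1 7 2 (by simp [Shell7.Adm]) (by norm_num) (by norm_num) (by norm_num) p e
  · exact Shell7.main1 11 3 (by simp [Shell7.Adm]) (by norm_num) (by norm_num) (by norm_num) p e
  · exact Shell7.main1 19 5 (by simp [Shell7.Adm]) (by norm_num) (by norm_num) (by norm_num) p e
  · exact Shell7.main1 43 11 (by simp [Shell7.Adm]) (by norm_num) (by norm_num) (by norm_num) p e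
  · exact Shell7.main1 67 17 (by simp [Shell7.Adm]) (by norm_num) (by norm_num) (by norm_num) p e
  · exact Shell7.main1 163 41 (by simp [Shell7.Adm]) (by norm_num) (by norm_num) (by norm_num) p e
end

section
/- Let p be a prime and let t be an integer with |t| < 2p, t ≠ p and t ≠ −p. Define a sequence of integers by a₀ = 1, a₁ = t, and a_{n+2} = t·a_{n+1} − p²·a_n for all n ≥ 0. If a_n = 0 for some n ≥ 1, then the least such n equals 1; equivalently, if in addition t ≠ 0, then a_n ≠ 0 for every n ≥ 0. -/
/-- Let `p` be a prime and `t` an integer with `|t| < 2p`, `t ≠ p`, `t ≠ −p`. Define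
`a₀ = 1`, `a₁ = t`, `a_{n+2} = t·a_{n+1} − p²·a_n`. If `a_n = 0` for some `n ≥ 1`, then the
least such `n` equals `1`; equivalently, if in addition `t ≠ 0`, then `a_n ≠ 0` for all
`n ≥ 0`. -/
theorem stmt_11 (p : ℕ) (hp : p.Prime) (t : ℤ)
    (htb : |t| < 2 * (p : ℤ)) (ht1 : t ≠ (p : ℤ)) (ht2 : t ≠ -(p : ℤ))
    (a : ℕ → ℤ) (h0 : a 0 = 1) (h1 : a 1 = t)
    (hrec : ∀ n, a (n + 2) = t * a (n + 1) - (p : ℤ) ^ 2 * a n) :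
    ((∃ n, 1 ≤ n ∧ a n = 0) → IsLeast {n : ℕ | 1 ≤ n ∧ a n = 0} 1) ∧
    (t ≠ 0 → ∀ n, a n ≠ 0) := by
  have key : t ≠ 0 → ∀ n, a n ≠ 0 := by
    intro ht0
    have hpp : Prime (p : ℤ) := Nat.prime_iff_prime_int.mp hp
    have hpos : (0 : ℤ) < p := by exact_mod_cast hp.pos
    have hnd : ¬ (p : ℤ) ∣ t := by
      rintro ⟨k, rfl⟩
      rw [abs_lt] at htb
      have hk1 : k < 2 := by nlinarith
      have hk2 : -2 < k := by nlinarith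
      interval_cases k <;> simp_all
    have hall : ∀ n, ¬ (p : ℤ) ∣ a n ∧ ¬ (p : ℤ) ∣ a (n + 1) := by
      intro n
      induction n with
      | zero =>
        refine ⟨?_, by simpa [h1] using hnd⟩
        rw [h0]
        exact hpp.not_dvd_one
      | succ k ih =>
        refine ⟨ih.2, fun h => ?_⟩
        rw [hrec k] at h
        have h2 : (p : ℤ) ∣ (p : ℤ) ^ 2 * a k := Dvd.intro _ (by ring : (p : ℤ) * (p * a k) = _)
        have h3 := (dvd_sub_left h2).mp h
        rcases hpp.dvd_or_dvd h3 with h4 | h4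
        · exact hnd h4
        · exact ih.2 h4
    intro n hn
    exact (hall n).1 (hn ▸ dvd_zero _)
  refine ⟨?_, key⟩
  rintro ⟨n, hn1, hn⟩
  have ht : t = 0 := by
    by_contra h
    exact key h n hn
  exact ⟨⟨le_refl 1, h1.trans ht⟩, fun m hm => hm.1⟩
end

section
/- For every positive integer m, if the set S = {(a,b) ∈ ℤ × ℤ : a² + b² = m} is nonempty, then ∑_{(a,b) ∈ S} (a⁴ − 6a²b² + b⁴) ≠ 0. In particular, the shell of norm m of the lattice ℤ² is not a spherical 4-design. -/
namespace Shell

local notation "G" => GaussianInt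

/-- Gaussian integers of norm n. -/
noncomputable def Z (n : ℕ) : Finset G :=
  (((Finset.Icc (-(n:ℤ)) n) ×ˢ (Finset.Icc (-(n:ℤ)) n)).image
    (fun p : ℤ × ℤ => (⟨p.1, p.2⟩ : G))).filter (fun z => z.norm = (n : ℤ))

lemma norm_eq (z : G) : z.norm = z.re ^ 2 + z.im ^ 2 := by
  rw [Zsqrtd.norm_def]; ring

lemma mem_Z {n : ℕ} {z : G} : z ∈ Z n ↔ z.norm = (n : ℤ) := by
  unfold Z
  rw [Finset.mem_filter]
  refine ⟨fun h => h.2, fun h => ⟨?_, h⟩⟩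
  rw [Finset.mem_image]
  refine ⟨(z.re, z.im), ?_, rfl⟩
  rw [norm_eq] at h
  simp only [Finset.mem_product, Finset.mem_Icc]
  have h1 := Int.le_self_sq z.re
  have h2 := Int.le_self_sq z.im
  have h3 := Int.le_self_sq (-z.re)
  have h4 := Int.le_self_sq (-z.im)
  have h5 := sq_nonneg z.re
  have h6 := sq_nonneg z.im
  rw [neg_sq] at h3 h4
  refine ⟨⟨?_, ?_⟩, ?_, ?_⟩ <;> linarith

/-- The sum of fourth powers. -/
noncomputable def S (n : ℕ) : G := ∑ z ∈ Z n, z ^ 4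

lemma star_S (n : ℕ) : star (S n) = S n := by
  unfold S
  rw [star_sum]
  refine Finset.sum_nbij' star star ?_ ?_ ?_ ?_ ?_
  · intro a ha; rw [mem_Z] at *; rw [Zsqrtd.norm_conj]; exact ha
  · intro a ha; rw [mem_Z] at *; rw [Zsqrtd.norm_conj]; exact ha
  · intro a _; simp
  · intro a _; simp
  · intro a _; simp

lemma re_S (n : ℕ) : (S n).re = ∑ z ∈ Z n, (z.re ^ 4 - 6 * z.re ^ 2 * z.im ^ 2 + z.im ^ 4) := by
  unfold S
  have : ∀ s : Finset G, (∑ z ∈ s, z ^ 4).re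
      = ∑ z ∈ s, (z.re ^ 4 - 6 * z.re ^ 2 * z.im ^ 2 + z.im ^ 4) := by
    intro s
    classical
    induction s using Finset.induction_on with
    | empty => simp
    | insert a s ha ih =>
      rw [Finset.sum_insert ha, Finset.sum_insert ha, Zsqrtd.re_add, ih]
      congr 1
      simp only [pow_succ, pow_zero, one_mul, Zsqrtd.re_mul, Zsqrtd.im_mul]
      ring
  exact this _

lemma dvd_star {a b : G} (h : a ∣ star b) : star a ∣ b := by
  obtain ⟨c, hc⟩ := h
  exact ⟨star c, by rw [← star_mul', ← hc, star_star]⟩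

lemma prime_star {p : G} (hp : Prime p) : Prime (star p) := by
  have := (MulEquiv.prime_iff (starMulAut : G ≃* G) (p := p)).2 hp
  exact this

lemma norm_dvd {a b : G} (h : a ∣ b) : a.norm ∣ b.norm := by
  obtain ⟨c, rfl⟩ := h
  exact ⟨c.norm, Zsqrtd.norm_mul a c⟩

lemma norm_pow' (a : G) (k : ℕ) : (a ^ k).norm = a.norm ^ k :=
  map_pow (Zsqrtd.normMonoidHom (d := -1)) a k

/-- If every element of norm q*n is divisible by p (of norm q), shells scale. -/
lemma Z_image {p : G} {q n : ℕ} (hq : p.norm = q) (hq0 : q ≠ 0)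
    (h : ∀ z ∈ Z (q * n), p ∣ z) : Z (q * n) = (Z n).image (fun w => p * w) := by
  ext z
  rw [Finset.mem_image]
  constructor
  · intro hz
    obtain ⟨w, rfl⟩ := h z hz
    refine ⟨w, ?_, rfl⟩
    rw [mem_Z, Zsqrtd.norm_mul, hq] at hz
    push_cast at hz
    rw [mem_Z]
    exact mul_left_cancel₀ (by exact_mod_cast hq0) hz
  · rintro ⟨w, hw, rfl⟩
    rw [mem_Z] at *
    rw [Zsqrtd.norm_mul, hq, hw]; push_cast; rfl

lemma sum_image_mul {p : G} (hp : p ≠ 0) (s : Finset G) :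
    ∑ z ∈ s.image (fun w => p * w), z ^ 4 = p ^ 4 * ∑ z ∈ s, z ^ 4 := by
  rw [Finset.sum_image, Finset.mul_sum]
  · simp [mul_pow]
  · intro a _ b _ h; exact mul_left_cancel₀ hp h

lemma split {p : G} (hp : Prime p) (hns : ¬ p ∣ star p) {q n : ℕ} (hq : p.norm = q)
    (hq0 : q ≠ 0) (hn : ¬ q ∣ n) (k : ℕ) :
    Z (q ^ (k+1) * n) = (Z (q ^ k * n)).image (fun w => p * w) ∪
      (Z n).image (fun w => (star p) ^ (k+1) * w) := by
  ext z
  rw [Finset.mem_union, Finset.mem_image, Finset.mem_image]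
  have hqz : (q : ℤ) ≠ 0 := by exact_mod_cast hq0
  constructor
  · intro hz
    by_cases hd : p ∣ z
    · left
      obtain ⟨w, rfl⟩ := hd
      refine ⟨w, ?_, rfl⟩
      rw [mem_Z, Zsqrtd.norm_mul, hq] at hz
      rw [mem_Z]
      apply mul_left_cancel₀ hqz
      rw [hz]; push_cast; ring
    · right
      have h1 : p ^ (k+1) ∣ z * star z := by
        rw [← Zsqrtd.norm_eq_mul_conj, mem_Z.1 hz]
        push_cast
        have : (q : G) = p * star p := by
          rw [← Zsqrtd.norm_eq_mul_conj, hq]; simp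
        rw [this, mul_pow, mul_assoc]
        exact dvd_mul_right _ _
      have h2 := dvd_star (hp.pow_dvd_of_dvd_mul_left _ hd h1)
      rw [star_pow] at h2
      obtain ⟨w, rfl⟩ := h2
      refine ⟨w, ?_, rfl⟩
      rw [mem_Z, Zsqrtd.norm_mul, norm_pow', Zsqrtd.norm_conj, hq] at hz
      rw [mem_Z]
      apply mul_left_cancel₀ (pow_ne_zero (k+1) hqz)
      rw [hz]; push_cast; ring
  · rintro (⟨w, hw, rfl⟩ | ⟨w, hw, rfl⟩)
    · rw [mem_Z] at *
      rw [Zsqrtd.norm_mul, hq, hw]; push_cast; ring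
    · rw [mem_Z] at *
      rw [Zsqrtd.norm_mul, norm_pow', Zsqrtd.norm_conj, hq, hw]; push_cast; ring

lemma S_split {p : G} (hp : Prime p) (hns : ¬ p ∣ star p) {q n : ℕ} (hq : p.norm = q)
    (hq0 : q ≠ 0) (hn : ¬ q ∣ n) (k : ℕ) :
    S (q ^ (k+1) * n) = p ^ 4 * S (q ^ k * n) + ((star p) ^ (k+1)) ^ 4 * S n := by
  unfold S
  rw [split hp hns hq hq0 hn k, Finset.sum_union, sum_image_mul hp.ne_zero,
    sum_image_mul (pow_ne_zero _ (prime_star hp).ne_zero)]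
  rw [Finset.disjoint_left]
  intro z h1 h2
  rw [Finset.mem_image] at h1 h2
  obtain ⟨w, _, rfl⟩ := h1
  obtain ⟨v, hv, h⟩ := h2
  have hd : p ∣ star p ^ (k+1) * v := ⟨w, h⟩
  rcases hp.dvd_or_dvd hd with h3 | h3
  · exact hns (hp.dvd_of_dvd_pow h3)
  · have := norm_dvd h3
    rw [mem_Z.1 hv, hq] at this
    exact hn (by exact_mod_cast this)

lemma S_pow {p : G} (hp : Prime p) (hns : ¬ p ∣ star p) {q n : ℕ} (hq : p.norm = q)
    (hq0 : q ≠ 0) (hn : ¬ q ∣ n) (k : ℕ) :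
    ((Z (q ^ k * n)).Nonempty → (Z n).Nonempty) ∧
      ∃ U : G, ¬ p ∣ U ∧ S (q ^ k * n) = U * S n := by
  induction k with
  | zero =>
    refine ⟨by simp, 1, ?_, by simp⟩
    exact fun h => hp.not_unit (isUnit_of_dvd_one h)
  | succ k ih =>
    obtain ⟨h1, U, hU, hS⟩ := ih
    constructor
    · rw [split hp hns hq hq0 hn k, Finset.union_nonempty, Finset.image_nonempty,
        Finset.image_nonempty]
      rintro (h | h)
      · exact h1 h
      · exact h
    · refine ⟨p ^ 4 * U + ((star p) ^ (k+1)) ^ 4, ?_, ?_⟩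
      · intro h
        have h2 : p ∣ p ^ 4 * U := Dvd.dvd.mul_right (dvd_pow_self p (by norm_num)) _
        rw [dvd_add_right h2] at h
        exact hns (hp.dvd_of_dvd_pow (hp.dvd_of_dvd_pow h))
      · rw [S_split hp hns hq hq0 hn k, hS]; ring

lemma S_ne (m : ℕ) (hm : 0 < m) (h : (Z m).Nonempty) : S m ≠ 0 := by
  induction m using Nat.strong_induction_on with
  | _ m ih =>
  obtain ⟨z, hz⟩ := h
  have hz' := mem_Z.1 hz
  have hz0 : z ≠ 0 := by
    rintro rfl
    simp at hz'
    omega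
  by_cases hu : IsUnit z
  · have h1 : z.norm.natAbs = 1 := Zsqrtd.norm_eq_one_iff.2 hu
    have h2 : m = 1 := by omega
    subst h2
    have : S 1 = ∑ z ∈ Z 1, 1 := by
      unfold S
      refine Finset.sum_congr rfl ?_
      intro w hw
      rw [mem_Z, norm_eq] at hw
      have e : w ^ 4 = 1 := by
        obtain ⟨a, b⟩ := w
        simp only at hw
        have ha : a ≤ 1 := by push_cast at hw; nlinarith [sq_nonneg b]
        have ha' : -1 ≤ a := by push_cast at hw; nlinarith [sq_nonneg b]
        have hb : b ≤ 1 := by push_cast at hw; nlinarith [sq_nonneg a]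
        have hb' : -1 ≤ b := by push_cast at hw; nlinarith [sq_nonneg a]
        interval_cases a <;> interval_cases b <;> first | (exfalso; revert hw; norm_num; done) | decide
      exact e
    rw [this, Finset.sum_const, nsmul_eq_mul, mul_one]
    exact Nat.cast_ne_zero.2 (Finset.card_ne_zero.2 ⟨z, hz⟩)
  · obtain ⟨p, hpi, hpz⟩ := WfDvdMonoid.exists_irreducible_factor hu hz0
    have hp : Prime p := hpi.prime
    obtain ⟨q, hq⟩ : ∃ q : ℕ, p.norm = q :=
      ⟨p.norm.natAbs, (Int.natAbs_of_nonneg (GaussianInt.norm_nonneg p)).symm⟩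
    have hq0 : q ≠ 0 := by
      rintro rfl
      exact hp.ne_zero ((Zsqrtd.norm_eq_zero_iff (by norm_num) p).1 (by simpa using hq))
    have hq1 : q ≠ 1 := by
      rintro rfl
      exact hp.not_unit (Zsqrtd.norm_eq_one_iff.1 (by rw [hq]; rfl))
    have hqm : q ∣ m := by
      have := norm_dvd hpz
      rw [hq, hz'] at this
      exact_mod_cast this
    by_cases hs : p ∣ star p
    · obtain ⟨n, rfl⟩ := hqm
      have hn : 0 < n := Nat.pos_of_mul_pos_left hm
      have hall : ∀ w ∈ Z (q * n), p ∣ w := by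
        intro w hw
        have h1 : p ∣ w * star w := by
          rw [← Zsqrtd.norm_eq_mul_conj, mem_Z.1 hw, ← hz', Zsqrtd.norm_eq_mul_conj]
          exact hpz.mul_right _
        rcases hp.dvd_or_dvd h1 with h2 | h2
        · exact h2
        · exact hs.trans (dvd_star h2)
      have hI := Z_image hq hq0 hall
      have hne : (Z n).Nonempty := by
        rw [← Finset.image_nonempty (f := fun w => p * w), ← hI]; exact ⟨z, hz⟩
      have : S (q * n) = p ^ 4 * S n := by
        unfold S; rw [hI, sum_image_mul hp.ne_zero]
      rw [this]
      refine mul_ne_zero (pow_ne_zero _ hp.ne_zero) (ih n ?_ hn hne)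
      have : 2 ≤ q := by omega
      nlinarith
    · obtain ⟨k, n, hn, rfl⟩ := Nat.exists_eq_pow_mul_and_not_dvd hm.ne' q hq1
      obtain ⟨h1, U, hU, hS⟩ := S_pow hp hs hq hq0 hn k
      have hn0 : 0 < n := Nat.pos_of_ne_zero (by rintro rfl; simp at hn)
      rw [hS]
      refine mul_ne_zero (by rintro rfl; simp at hU) (ih n ?_ hn0 (h1 ⟨z, hz⟩))
      have hk : k ≠ 0 := by
        rintro rfl
        simp at hqm
        exact hn hqm
      have : 1 < q ^ k := Nat.one_lt_pow hk (by omega)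
      nlinarith

end Shell

/-- For every positive integer `m`, if the shell `S = {(a,b) ∈ ℤ × ℤ : a² + b² = m}` is
nonempty, then `∑_{(a,b) ∈ S} (a⁴ − 6a²b² + b⁴) ≠ 0`; in particular the shell of norm `m`
of the lattice `ℤ²` is not a spherical 4-design. -/
theorem stmt_12 (m : ℕ) (hm : 0 < m)
    (hne : {p : ℤ × ℤ | p.1 ^ 2 + p.2 ^ 2 = (m : ℤ)}.Nonempty) :
    (∑ᶠ p ∈ {p : ℤ × ℤ | p.1 ^ 2 + p.2 ^ 2 = (m : ℤ)},
      (p.1 ^ 4 - 6 * p.1 ^ 2 * p.2 ^ 2 + p.2 ^ 4)) ≠ 0 := by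
  have hset : {p : ℤ × ℤ | p.1 ^ 2 + p.2 ^ 2 = (m : ℤ)} =
      (((Shell.Z m).image (fun z => (z.re, z.im)) : Finset (ℤ × ℤ)) : Set (ℤ × ℤ)) := by
    ext ⟨a, b⟩
    simp only [Set.mem_setOf_eq, Finset.coe_image, Set.mem_image, Finset.mem_coe]
    constructor
    · intro h
      exact ⟨⟨a, b⟩, Shell.mem_Z.2 (by rw [Shell.norm_eq]; exact h), rfl⟩
    · rintro ⟨z, hz, h⟩
      rw [Shell.mem_Z, Shell.norm_eq] at hz
      obtain ⟨rfl, rfl⟩ := Prod.mk.inj h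
      exact hz
  have hZ : (Shell.Z m).Nonempty := by
    rw [hset] at hne
    simpa using hne
  rw [hset, finsum_mem_coe_finset, Finset.sum_image]
  · intro h0
    apply Shell.S_ne m hm hZ
    have h1 := Shell.re_S m
    have h2 := congrArg Zsqrtd.im (Shell.star_S m)
    rw [Zsqrtd.im_star] at h2
    apply Zsqrtd.ext
    · rw [h1]; exact h0
    · have : (Shell.S m).im = 0 := by omega
      simpa using this
  · intro z _ w _ h
    obtain ⟨h1, h2⟩ := Prod.mk.inj h
    exact Zsqrtd.ext h1 h2
end

section
/- For every positive integer m, if the set S = {(a,b) ∈ ℤ × ℤ : a² + ab + b² = m} is nonempty, then ∑_{(a,b) ∈ S} ((2a+b)⁶ − 45(2a+b)⁴b² + 135(2a+b)²b⁴ − 27b⁶) ≠ 0. In particular, the shell of norm m of the hexagonal lattice A₂ is not a spherical 6-design. -/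
namespace A2

open QuadraticAlgebra

abbrev R := QuadraticAlgebra ℤ (-1) 1

theorem nrm (z : R) : z.norm = z.re ^ 2 + z.re * z.im + z.im ^ 2 := by
  rw [norm_def]; ring

theorem nrm_nonneg (z : R) : 0 ≤ z.norm := by
  rw [nrm]; nlinarith [sq_nonneg (z.re + z.im), sq_nonneg z.re, sq_nonneg z.im]

theorem nrm_eq_zero {z : R} (h : z.norm = 0) : z = 0 := by
  rw [nrm] at h
  have h1 : z.re = 0 := by
    have : z.re ^ 2 = 0 := by
      nlinarith [sq_nonneg (z.re + z.im), sq_nonneg z.re, sq_nonneg z.im]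
    exact pow_eq_zero_iff (two_ne_zero) |>.1 this
  have h2 : z.im = 0 := by
    have : z.im ^ 2 = 0 := by
      nlinarith [sq_nonneg (z.re + z.im), sq_nonneg z.re, sq_nonneg z.im]
    exact pow_eq_zero_iff (two_ne_zero) |>.1 this
  ext <;> simp [h1, h2]

theorem nrm_pos {z : R} (h : z ≠ 0) : 0 < z.norm :=
  lt_of_le_of_ne (nrm_nonneg z) (fun h' => h (nrm_eq_zero h'.symm))

instance : NoZeroDivisors R where
  eq_zero_or_eq_zero_of_mul_eq_zero := by
    intro a b h
    have : a.norm * b.norm = 0 := by rw [← map_mul, h, QuadraticAlgebra.norm_zero]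
    rcases mul_eq_zero.1 this with h | h
    · exact Or.inl (nrm_eq_zero h)
    · exact Or.inr (nrm_eq_zero h)

instance : IsDomain R := NoZeroDivisors.to_isDomain R

theorem mul_star_self (z : R) : z * star z = ((z.norm : ℤ) : R) := by
  rw [← algebraMap_norm_eq_mul_star]; simp

theorem round_ex (u n : ℤ) (hn : 0 < n) : ∃ k, -n ≤ 2 * (u - k * n) ∧ 2 * (u - k * n) ≤ n := by
  refine ⟨(2 * u + n) / (2 * n), ?_⟩
  have h1 := Int.mul_ediv_add_emod (2 * u + n) (2 * n)
  have h2 := Int.emod_nonneg (2 * u + n) (show 2 * n ≠ 0 by omega)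
  have h3 := Int.emod_lt_of_pos (2 * u + n) (show 0 < 2 * n by omega)
  constructor <;> nlinarith

theorem div_ex (x y : R) (hy : y ≠ 0) : ∃ q : R, (x - q * y).norm < y.norm := by
  have hn := nrm_pos hy
  set n := y.norm with hnd
  obtain ⟨k, hk1, hk2⟩ := round_ex (x * star y).re n hn
  obtain ⟨l, hl1, hl2⟩ := round_ex (x * star y).im n hn
  refine ⟨⟨k, l⟩, ?_⟩
  have e : (x - ⟨k, l⟩ * y) * star y =
      ⟨(x * star y).re - k * n, (x * star y).im - l * n⟩ := by
    rw [sub_mul, mul_assoc, mul_star_self, ← hnd]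
    ext <;> simp
  have e2 := congrArg QuadraticAlgebra.norm e
  rw [map_mul, QuadraticAlgebra.norm_star, ← hnd, nrm ⟨(x * star y).re - k * n, (x * star y).im - l * n⟩] at e2
  simp only at e2
  generalize (x * star y).re - k * n = s at *
  generalize (x * star y).im - l * n = t at *
  have b1 : 4 * s ^ 2 ≤ n ^ 2 := by nlinarith
  have b2 : 4 * t ^ 2 ≤ n ^ 2 := by nlinarith
  have b3 : 4 * (s * t) ≤ n ^ 2 := by nlinarith [sq_nonneg (s - t)]
  by_contra hc
  push Not at hc
  nlinarith

instance : IsPrincipalIdealRing R where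
  principal := by
    intro I
    by_cases hI : I = ⊥
    · exact ⟨⟨0, by simp [hI]⟩⟩
    obtain ⟨x0, hx0, hx0'⟩ := Submodule.exists_mem_ne_zero_of_ne_bot hI
    have hex : ∃ k : ℕ, ∃ x ∈ I, x ≠ 0 ∧ x.norm.natAbs = k := ⟨_, x0, hx0, hx0', rfl⟩
    classical
    obtain ⟨y, hy, hy0, hyn⟩ := Nat.find_spec hex
    refine ⟨⟨y, le_antisymm ?_ ?_⟩⟩
    · intro x hx
      obtain ⟨q, hq⟩ := div_ex x y hy0
      have hm : x - q * y ∈ I := I.sub_mem hx (I.mul_mem_left q hy)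
      have hz : x - q * y = 0 := by
        by_contra h0
        have := Nat.find_min' hex ⟨_, hm, h0, rfl⟩
        have h1 := nrm_nonneg (x - q * y)
        omega
      rw [Submodule.mem_span_singleton]
      exact ⟨q, by rw [smul_eq_mul]; exact (sub_eq_zero.1 hz).symm⟩
    · rw [Submodule.span_singleton_le_iff_mem]; exact hy

theorem isUnit_iff (z : R) : IsUnit z ↔ z.norm = 1 := by
  rw [isUnit_iff_norm_isUnit, Int.isUnit_iff]
  have := nrm_nonneg z
  omega

theorem prime_of_norm {p : ℕ} (hp : p.Prime) {a : R} (h : a.norm = p) : Prime a := by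
  apply Irreducible.prime
  refine ⟨fun hu => ?_, fun x y hxy => ?_⟩
  · rw [isUnit_iff] at hu
    have := hp.one_lt
    omega
  · have : x.norm * y.norm = p := by rw [← map_mul, ← hxy, h]
    have hx := nrm_nonneg x
    have hy := nrm_nonneg y
    rw [isUnit_iff, isUnit_iff]
    lift x.norm to ℕ using hx with u
    lift y.norm to ℕ using hy with v
    norm_cast at *
    rcases Nat.prime_mul_iff.1 (this ▸ hp) with h | h
    · exact Or.inr h.2
    · exact Or.inl h.2

theorem prime_or {p : ℕ} (hp : p.Prime) : Prime (p : R) ∨ ∃ a : R, a.norm = p := by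
  by_cases h : Irreducible (p : R)
  · exact Or.inl h.prime
  right
  have hu : ¬ IsUnit (p : R) := by
    rw [isUnit_iff, QuadraticAlgebra.norm_natCast]
    have := hp.one_lt
    norm_cast
    nlinarith
  rw [irreducible_iff] at h
  push Not at h
  obtain ⟨x, y, hxy, h1, h2⟩ := h hu
  refine ⟨x, ?_⟩
  have : x.norm * y.norm = p ^ 2 := by rw [← map_mul, ← hxy, QuadraticAlgebra.norm_natCast]
  have hx := nrm_nonneg x
  have hy := nrm_nonneg y
  rw [isUnit_iff] at h1 h2
  lift x.norm to ℕ using hx with u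
  lift y.norm to ℕ using hy with v
  norm_cast at *
  exact ((Nat.Prime.mul_eq_prime_sq_iff hp h1 h2).1 this).1

theorem sh_fin (n : ℤ) : {z : R | z.norm = n}.Finite := by
  have : ((QuadraticAlgebra.equivProd (-1 : ℤ) 1) ⁻¹'
      (Set.Icc (-(2 * n)) (2 * n) ×ˢ Set.Icc (-(2 * n)) (2 * n))).Finite := by
    apply Set.Finite.preimage (Equiv.injective _).injOn
    exact (Set.finite_Icc _ _).prod (Set.finite_Icc _ _)
  refine this.subset ?_
  intro z hz
  have hz : z.norm = n := hz
  rw [nrm] at hz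
  have a1 : z.re ^ 2 ≤ 2 * n := by nlinarith [sq_nonneg (z.re + 2 * z.im), sq_nonneg z.re]
  have a2 : z.im ^ 2 ≤ 2 * n := by nlinarith [sq_nonneg (2 * z.re + z.im), sq_nonneg z.im]
  have c1 := Int.le_self_sq z.re
  have c2 := Int.le_self_sq z.im
  have d1 := Int.le_self_sq (-z.re)
  have d2 := Int.le_self_sq (-z.im)
  simp only [Set.mem_preimage, QuadraticAlgebra.equivProd, Set.mem_prod, Set.mem_Icc, Equiv.coe_fn_mk]
  refine ⟨⟨?_, ?_⟩, ?_, ?_⟩ <;> nlinarith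

noncomputable def sh (n : ℤ) : Finset R := (sh_fin n).toFinset

theorem mem_sh {n : ℤ} {z : R} : z ∈ sh n ↔ z.norm = n := by simp [sh]

noncomputable def S (n : ℤ) : R := ∑ z ∈ sh n, z ^ 6

noncomputable instance : DecidableEq R := Classical.decEq _

theorem sum_img (a : R) (ha : a ≠ 0) (n : ℤ) :
    ∑ z ∈ (sh n).image (a * ·), z ^ 6 = a ^ 6 * S n := by
  rw [Finset.sum_image (fun x _ y _ h => mul_left_cancel₀ ha h), S, Finset.mul_sum]
  simp [mul_pow]

theorem mem_img {a : R} (ha : a ≠ 0) {n : ℤ} {z : R} :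
    z ∈ (sh n).image (a * ·) ↔ a ∣ z ∧ z.norm = a.norm * n := by
  simp only [Finset.mem_image, mem_sh]
  constructor
  · rintro ⟨w, hw, rfl⟩
    exact ⟨dvd_mul_right _ _, by rw [map_mul, hw]⟩
  · rintro ⟨⟨w, rfl⟩, h⟩
    refine ⟨w, ?_, rfl⟩
    rw [map_mul] at h
    exact mul_left_cancel₀ (nrm_pos ha).ne' h

theorem dvd_star {a z : R} : star a ∣ z ↔ a ∣ star z := by
  constructor
  · rintro ⟨w, rfl⟩
    exact ⟨star w, by simp [mul_comm]⟩
  · rintro ⟨w, h⟩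
    exact ⟨star w, by rw [← star_star z, h]; simp [mul_comm]⟩

theorem dvd_cases {a : R} (ha : Prime a) {n : ℤ} {z : R} (h : z.norm = a.norm * n) :
    a ∣ z ∨ star a ∣ z := by
  rw [dvd_star]
  apply ha.dvd_or_dvd
  rw [mul_star_self, h, Int.cast_mul, ← mul_star_self, mul_assoc]
  exact dvd_mul_right _ _

/-- inert or ramified case -/
theorem S_self {a : R} (ha : Prime a) (hs : a ∣ star a) (n : ℤ) :
    S (a.norm * n) = a ^ 6 * S n := by
  rw [← sum_img a ha.ne_zero, S]
  congr 1
  ext z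
  rw [mem_img ha.ne_zero, mem_sh]
  refine ⟨fun h => ⟨?_, h⟩, fun h => h.2⟩
  rcases dvd_cases ha h with h | h
  · exact h
  · exact hs.trans h

theorem ne_of_ne {a : R} (ha : Prime a) {n : ℤ} (h : (sh (a.norm * n)).Nonempty) :
    (sh n).Nonempty := by
  obtain ⟨z, hz⟩ := h
  rw [mem_sh] at hz
  rcases dvd_cases ha hz with h | h
  · have := mem_img ha.ne_zero |>.2 ⟨h, hz⟩
    obtain ⟨w, hw, -⟩ := Finset.mem_image.1 this
    exact ⟨w, hw⟩
  · have h0 : star a ≠ 0 := by simpa using ha.ne_zero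
    have := mem_img h0 |>.2 ⟨h, by rw [QuadraticAlgebra.norm_star]; exact hz⟩
    obtain ⟨w, hw, -⟩ := Finset.mem_image.1 this
    exact ⟨w, hw⟩

open Classical in
theorem split_aux {a : R} (ha : Prime a) (hs : ¬ a ∣ star a) (n : ℤ) :
    S (a.norm * n) + ∑ z ∈ (sh (a.norm * n)).filter (fun z => ((a.norm : ℤ) : R) ∣ z), z ^ 6
      = (a ^ 6 + star a ^ 6) * S n := by
  have h0 : star a ≠ 0 := by simpa using ha.ne_zero
  rw [add_mul, ← sum_img a ha.ne_zero, ← sum_img _ h0, ← Finset.sum_union_inter, S]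
  congr 2
  · ext z
    rw [Finset.mem_union, mem_img ha.ne_zero, mem_img h0, mem_sh, QuadraticAlgebra.norm_star, ← or_and_right]
    exact ⟨fun h => ⟨dvd_cases ha h, h⟩, fun h => h.2⟩
  · ext z
    rw [Finset.mem_inter, mem_img ha.ne_zero, mem_img h0, Finset.mem_filter, mem_sh, QuadraticAlgebra.norm_star,
      ← mul_star_self]
    constructor
    · rintro ⟨h, h'⟩
      exact ⟨⟨(dvd_mul_right _ _).trans h', h⟩, (dvd_mul_left _ _).trans h', h⟩
    · rintro ⟨⟨h, h1⟩, ⟨w, rfl⟩, -⟩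
      refine ⟨h1, ?_⟩
      rw [mul_comm]
      apply mul_dvd_mul_left
      exact (ha.dvd_or_dvd h).resolve_left hs

open Classical in
theorem split1 {a : R} (ha : Prime a) (hs : ¬ a ∣ star a) (n : ℤ) (hn : ¬ a.norm ∣ n) :
    S (a.norm * n) = (a ^ 6 + star a ^ 6) * S n := by
  rw [← split_aux ha hs, Finset.filter_false_of_mem, Finset.sum_empty, add_zero]
  rintro z hz ⟨w, rfl⟩
  rw [mem_sh, map_mul, QuadraticAlgebra.norm_intCast, pow_two, mul_assoc] at hz
  have := mul_left_cancel₀ (nrm_pos ha.ne_zero).ne' hz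
  exact hn ⟨_, by simpa using this.symm⟩

open Classical in
theorem split2 {a : R} (ha : Prime a) (hs : ¬ a ∣ star a) (n : ℤ) :
    S (a.norm * (a.norm * n)) + ((a.norm : ℤ) : R) ^ 6 * S n
      = (a ^ 6 + star a ^ 6) * S (a.norm * n) := by
  have h0 : ((a.norm : ℤ) : R) ≠ 0 := by
    rw [← mul_star_self]
    exact mul_ne_zero ha.ne_zero (by simpa using ha.ne_zero)
  rw [← split_aux ha hs, ← sum_img _ h0]
  congr 2
  ext z
  rw [mem_img h0, Finset.mem_filter, mem_sh, QuadraticAlgebra.norm_intCast, and_comm]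
  simp [pow_two, mul_assoc]

theorem tr_ex (z : R) : z + star z = ((2 * z.re + z.im : ℤ) : R) := by
  ext <;> simp; ring

theorem split_pow {a : R} (ha : Prime a) (hs : ¬ a ∣ star a) {p : ℕ} (hp : p.Prime)
    (hpa : a.norm = p) (n : ℤ) (hn : ¬ (p : ℤ) ∣ n) (k : ℕ) :
    ∃ u v : ℤ, ¬ (p : ℤ) ∣ u ∧ ¬ (p : ℤ) ∣ v ∧ S ((p : ℤ) ^ k * n) = (u : R) * S n ∧
      S ((p : ℤ) ^ (k + 1) * n) = (v : R) * S n := by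
  have hpp : Prime (p : ℤ) := Nat.prime_iff_prime_int.1 hp
  obtain ⟨t, ht⟩ : ∃ t : ℤ, a ^ 6 + star a ^ 6 = (t : R) := ⟨_, by rw [← star_pow, tr_ex]⟩
  have htp : ¬ (p : ℤ) ∣ t := by
    rintro ⟨c, rfl⟩
    apply hs
    apply ha.dvd_of_dvd_pow (n := 6)
    rw [← dvd_add_right (dvd_pow_self a (by norm_num : 6 ≠ 0)), ht, ← hpa, Int.cast_mul,
      ← mul_star_self, mul_assoc]
    exact dvd_mul_right _ _
  induction k with
  | zero =>
    refine ⟨1, t, ?_, htp, by simp, ?_⟩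
    · exact fun h => hpp.not_isUnit (isUnit_of_dvd_one h)
    · rw [← ht, ← split1 ha hs n (by rwa [hpa]), hpa]; simp
  | succ k ih =>
    obtain ⟨u, v, hu, hv, h1, h2⟩ := ih
    refine ⟨v, t * v - p ^ 6 * u, hv, ?_, h2, ?_⟩
    · intro h
      rw [dvd_sub_left ((dvd_pow_self _ (by norm_num)).mul_right _)] at h
      rcases hpp.dvd_or_dvd h with h | h
      · exact htp h
      · exact hv h
    · have := split2 ha hs (p ^ k * n)
      rw [hpa, ht, ← mul_assoc (p : ℤ) (p ^ k) n, ← pow_succ', ← mul_assoc, ← pow_succ', h1, h2,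
        Int.cast_natCast] at this
      rw [eq_sub_of_add_eq this]
      push_cast
      ring

theorem unit6 {z : R} (h : z.norm = 1) : z ^ 6 = 1 := by
  obtain ⟨x, y⟩ := z
  rw [nrm] at h
  simp only at h
  have hx : x ^ 2 ≤ 1 := by nlinarith [sq_nonneg (x + 2 * y), sq_nonneg x]
  have hy : y ^ 2 ≤ 1 := by nlinarith [sq_nonneg (2 * x + y), sq_nonneg y]
  have : -1 ≤ x := by nlinarith
  have : x ≤ 1 := by nlinarith
  have : -1 ≤ y := by nlinarith
  have : y ≤ 1 := by nlinarith
  interval_cases x <;> interval_cases y <;> first | (exfalso; omega) | (ext <;> rfl)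

theorem main (m : ℕ) : 0 < m → (sh m).Nonempty → S m ≠ 0 := by
  induction m using Nat.strong_induction_on with
  | _ m ih =>
  intro hm hne
  by_cases h1 : m = 1
  · subst h1
    have : S ((1 : ℕ) : ℤ) = ((sh ((1 : ℕ) : ℤ)).card : R) := by
      rw [S, Finset.sum_congr rfl (fun z hz => unit6 (by simpa using mem_sh.1 hz))]
      simp
    rw [this]
    intro h
    have h := congrArg QuadraticAlgebra.re h
    simp at h
    simp [h] at hne
  obtain ⟨p, hp, hpm⟩ := Nat.exists_prime_and_dvd h1
  have hp1 := hp.one_lt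
  rcases prime_or hp with hpr | ⟨a, ha⟩
  · have hself : (p : R) ∣ star (p : R) := by simp
    have hsq : p ^ 2 ∣ m := by
      obtain ⟨z, hz⟩ := hne
      rw [mem_sh] at hz
      obtain ⟨c, hc⟩ := hpm
      have : (p : R) ∣ z * star z := by
        rw [mul_star_self, hz, hc]; push_cast; exact dvd_mul_right _ _
      have : (p : R) ∣ z := by
        rcases hpr.dvd_or_dvd this with h | h
        · exact h
        · rw [← dvd_star] at h; simpa using h
      obtain ⟨w, rfl⟩ := this
      rw [map_mul, QuadraticAlgebra.norm_natCast] at hz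
      have h2 : (p ^ 2 : ℤ) ∣ (m : ℤ) := ⟨_, by rw [← hz]⟩
      exact_mod_cast h2
    obtain ⟨n, rfl⟩ := hsq
    have hn : 0 < n := Nat.pos_of_mul_pos_left hm
    have e : ((p ^ 2 * n : ℕ) : ℤ) = (p : R).norm * (n : ℤ) := by
      rw [QuadraticAlgebra.norm_natCast]; push_cast; rfl
    rw [e] at hne ⊢
    rw [S_self hpr hself]
    refine mul_ne_zero (pow_ne_zero _ hpr.ne_zero) (ih n ?_ hn (ne_of_ne hpr hne))
    have : 1 < p ^ 2 := Nat.one_lt_pow (by norm_num) hp1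
    nlinarith
  · have hap := prime_of_norm hp ha
    by_cases hs : a ∣ star a
    · obtain ⟨n, rfl⟩ := hpm
      have hn : 0 < n := Nat.pos_of_mul_pos_left hm
      have e : ((p * n : ℕ) : ℤ) = a.norm * (n : ℤ) := by
        rw [ha]; push_cast; rfl
      rw [e] at hne ⊢
      rw [S_self hap hs]
      refine mul_ne_zero (pow_ne_zero _ hap.ne_zero) (ih n ?_ hn (ne_of_ne hap hne))
      nlinarith
    · obtain ⟨k, n, hn, rfl⟩ := Nat.exists_eq_pow_mul_and_not_dvd hm.ne' p hp.ne_one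
      have hn0 : 0 < n := Nat.pos_of_mul_pos_left hm
      obtain ⟨u, v, hu, -, h, -⟩ :=
        split_pow hap hs hp ha n (by rwa [Int.natCast_dvd_natCast]) k
      push_cast at hne ⊢
      rw [h]
      have hk : k ≠ 0 := by
        rintro rfl
        simp at hpm
        exact hn hpm
      have hne' : (sh n).Nonempty := by
        clear h hpm hm ih h1 hk
        induction k with
        | zero => simpa using hne
        | succ k ihk =>
          apply ihk
          apply ne_of_ne hap
          rwa [ha, ← mul_assoc, ← pow_succ']
      have : 1 < p ^ k := Nat.one_lt_pow hk hp1
      refine mul_ne_zero ?_ (ih n (by nlinarith) hn0 hne')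
      intro h0
      apply hu
      have := congrArg QuadraticAlgebra.re h0
      simp at this
      simp [this]

theorem star_S (n : ℤ) : star (S n) = S n := by
  rw [S, star_sum]
  refine Finset.sum_bij' (fun z _ => star z) (fun z _ => star z) ?_ ?_ ?_ ?_ ?_
  · intro z hz; simpa [mem_sh] using hz
  · intro z hz; simpa [mem_sh] using hz
  · simp
  · simp
  · simp

theorem poly_eq (z : R) :
    (((2 * z.re + z.im) ^ 6 - 45 * (2 * z.re + z.im) ^ 4 * z.im ^ 2
        + 135 * (2 * z.re + z.im) ^ 2 * z.im ^ 4 - 27 * z.im ^ 6 : ℤ) : R)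
      = 32 * (z ^ 6 + star (z ^ 6)) := by
  rw [tr_ex]
  have : (32 : R) = ((32 : ℤ) : R) := by norm_num
  rw [this, ← Int.cast_mul]
  congr 1
  simp only [pow_succ, pow_zero, one_mul, re_mul, im_mul]
  ring

end A2

/-- For every positive integer `m`, if the shell `S = {(a,b) ∈ ℤ × ℤ : a² + ab + b² = m}`
of the hexagonal lattice `A₂` is nonempty, then
`∑_{(a,b) ∈ S} ((2a+b)⁶ − 45(2a+b)⁴b² + 135(2a+b)²b⁴ − 27b⁶) ≠ 0`; in particular the
shell of norm `m` of `A₂` is not a spherical 6-design. -/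
theorem stmt_13 (m : ℕ) (hm : 0 < m)
    (hne : {p : ℤ × ℤ | p.1 ^ 2 + p.1 * p.2 + p.2 ^ 2 = (m : ℤ)}.Nonempty) :
    (∑ᶠ p ∈ {p : ℤ × ℤ | p.1 ^ 2 + p.1 * p.2 + p.2 ^ 2 = (m : ℤ)},
      ((2 * p.1 + p.2) ^ 6 - 45 * (2 * p.1 + p.2) ^ 4 * p.2 ^ 2
        + 135 * (2 * p.1 + p.2) ^ 2 * p.2 ^ 4 - 27 * p.2 ^ 6)) ≠ 0 := by

  have e : {p : ℤ × ℤ | p.1 ^ 2 + p.1 * p.2 + p.2 ^ 2 = (m : ℤ)} =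
      ((A2.sh m).image (fun z => (z.re, z.im)) : Finset (ℤ × ℤ)) := by
    ext ⟨x, y⟩
    simp only [Set.mem_ofPred_eq, Finset.coe_image, Set.mem_image, Finset.mem_coe, A2.mem_sh,
      A2.nrm, Prod.mk.injEq]
    constructor
    · intro h
      exact ⟨⟨x, y⟩, h, rfl, rfl⟩
    · rintro ⟨z, h, rfl, rfl⟩
      exact h
  rw [e] at hne ⊢
  rw [finsum_mem_coe_finset, Finset.sum_image
    (fun z _ w _ h => QuadraticAlgebra.ext (Prod.mk.inj h).1 (Prod.mk.inj h).2)]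
  intro h
  have h := congrArg (Int.cast : ℤ → A2.R) h
  rw [Int.cast_sum, Finset.sum_congr rfl (fun z _ => A2.poly_eq z), ← Finset.mul_sum,
    Finset.sum_add_distrib, ← star_sum, Int.cast_zero] at h
  change 32 * (A2.S m + star (A2.S m)) = 0 at h
  rw [A2.star_S] at h
  have hS := A2.main m hm (by simpa using hne)
  apply hS
  have h2 : ((64 : ℤ) : A2.R) * A2.S m = 0 := by rw [← h]; push_cast; ring
  refine (mul_eq_zero.1 h2).resolve_left ?_
  intro h3
  have h4 := congrArg QuadraticAlgebra.re h3
  rw [QuadraticAlgebra.re_intCast, QuadraticAlgebra.re_zero] at h4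
  norm_num at h4
end

section
/- Let d ∈ {2, 7, 11, 19, 43, 67, 163}, and define b_d : {positive integers} → ℚ by b_d(m) = (1/2)·∑_{(a,b) ∈ S_d(m)} V_d(a,b). Then b_d(1) = 1, and b_d(m·n) = b_d(m)·b_d(n) for all coprime positive integers m and n. -/
/-- The value `V_d(a,b)` of the harmonic polynomial `x² − y²` at the point of `ℝ² = ℂ`
corresponding to `(a,b)` under the standard embedding of the ring of integers of `ℚ(√−d)`. -/
def Vf (d : ℕ) (p : ℤ × ℤ) : ℚ :=
  if d % 4 = 3 then ((2 * (p.1 : ℚ) + (p.2 : ℚ)) ^ 2 - (d : ℚ) * (p.2 : ℚ) ^ 2) / 4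
  else (p.1 : ℚ) ^ 2 - (d : ℚ) * (p.2 : ℚ) ^ 2

/-- The shell of norm `m`: `S_d(m) = {(a,b) ∈ ℤ × ℤ : Q_d(a,b) = m}`. -/
def shell (d m : ℕ) : Set (ℤ × ℤ) := {p | Qf d p = (m : ℤ)}


namespace Aux14

def N (t k : ℤ) (p : ℤ × ℤ) : ℤ := p.1 ^ 2 + t * p.1 * p.2 + k * p.2 ^ 2

def mu (t k : ℤ) (p q : ℤ × ℤ) : ℤ × ℤ :=
  (p.1 * q.1 - k * p.2 * q.2, p.1 * q.2 + p.2 * q.1 + t * p.2 * q.2)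

def V (t k : ℤ) (p : ℤ × ℤ) : ℚ :=
  (p.1 : ℚ) ^ 2 + t * p.1 * p.2 + ((t : ℚ) ^ 2 / 2 - k) * (p.2 : ℚ) ^ 2

def W (t : ℤ) (p : ℤ × ℤ) : ℚ := ((p.1 : ℚ) + t * p.2 / 2) * p.2

lemma N_mu (t k : ℤ) (p q : ℤ × ℤ) : N t k (mu t k p q) = N t k p * N t k q := by
  simp only [N, mu]; ring

lemma V_mu (t k : ℤ) (p q : ℤ × ℤ) :
    V t k (mu t k p q) = V t k p * V t k q - (4 * k - t ^ 2) * (W t p * W t q) := by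
  simp only [V, W, mu]; push_cast; ring

lemma form_one (D : ℤ)
    (hred : ∀ A B C : ℤ, 0 < A → -A ≤ B → B ≤ A → A ≤ C → 4 * A * C - B ^ 2 = D → A = 1)
    (hD : 0 < D) :
    ∀ (n : ℕ) (A B C : ℤ), A.toNat = n → 0 < A → 4 * A * C - B ^ 2 = D →
      ∃ u v : ℤ, A * u ^ 2 + B * u * v + C * v ^ 2 = 1 := by
  intro n
  induction n using Nat.strong_induction_on with
  | _ n ih =>
    intro A B C hn hA h
    obtain ⟨s, hs1, hs2⟩ : ∃ s : ℤ, -A ≤ B + 2 * A * s ∧ B + 2 * A * s ≤ A := by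
      refine ⟨-((B + A) / (2 * A)), ?_, ?_⟩
      · have h1 := Int.emod_nonneg (B + A) (show 2 * A ≠ 0 by omega)
        have h2 := Int.emod_add_mul_ediv (B + A) (2 * A)
        linarith
      · have h1 := Int.emod_lt_of_pos (B + A) (show 0 < 2 * A by omega)
        have h2 := Int.emod_add_mul_ediv (B + A) (2 * A)
        linarith
    obtain ⟨B', hB'⟩ : ∃ B', B' = B + 2 * A * s := ⟨_, rfl⟩
    obtain ⟨C', hC'⟩ : ∃ C', C' = A * s ^ 2 + B * s + C := ⟨_, rfl⟩
    rw [← hB'] at hs1 hs2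
    have hdisc : 4 * A * C' - B' ^ 2 = D := by rw [hB', hC', ← h]; ring
    by_cases hAC : A ≤ C'
    · have := hred A B' C' hA hs1 hs2 hAC hdisc
      exact ⟨1, 0, by rw [this]; ring⟩
    · have hC0 : 0 < C' := by
        by_contra hc
        push Not at hc
        nlinarith [sq_nonneg B', mul_nonneg hA.le (neg_nonneg.mpr hc)]
      obtain ⟨u, v, huv⟩ := ih C'.toNat (by omega) C' B' A rfl hC0 (by rw [← hdisc]; ring)
      refine ⟨v + s * u, u, ?_⟩
      rw [← huv, hB', hC']; ring

section
variable (t k : ℤ)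

lemma N_nonneg (hD : 7 ≤ 4 * k - t ^ 2) (p : ℤ × ℤ) : 0 ≤ N t k p := by
  simp only [N]
  nlinarith [sq_nonneg (2 * p.1 + t * p.2), mul_nonneg (show 0 ≤ 4 * k - t ^ 2 by omega) (sq_nonneg p.2)]

lemma units (hD : 7 ≤ 4 * k - t ^ 2) (p : ℤ × ℤ) (h : N t k p = 1) :
    p = (1, 0) ∨ p = (-1, 0) := by
  obtain ⟨a, b⟩ := p
  simp only [N] at h
  have hb : b = 0 := by
    by_contra hb
    have : 1 ≤ b ^ 2 := by have := sq_pos_of_ne_zero hb; omega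
    nlinarith [sq_nonneg (2 * a + t * b), mul_le_mul hD this (by norm_num) (by omega)]
  subst hb
  have : (a - 1) * (a + 1) = 0 := by linear_combination h
  rcases mul_eq_zero.mp this with h | h
  · left; ext <;> simp; omega
  · right; ext <;> simp; omega

lemma prim (hF : ∀ A B C : ℤ, 0 < A → 4 * A * C - B ^ 2 = 4 * k - t ^ 2 →
      ∃ u v : ℤ, A * u ^ 2 + B * u * v + C * v ^ 2 = 1)
    (m n : ℤ) (hm : 0 < m) (z : ℤ × ℤ) (hz : N t k z = m * n)
    (hp : IsCoprime z.1 z.2) :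
    ∃ x y, N t k x = m ∧ N t k y = n ∧ mu t k x y = z := by
  obtain ⟨a, b⟩ := z
  obtain ⟨q, r, hqr⟩ := hp
  simp only [N] at hz hqr
  -- w = (p, q) with a q + b p + t b q = 1
  obtain ⟨p, hpp⟩ : ∃ p, p = r - t * q := ⟨_, rfl⟩
  have hw : a * q + b * p + t * b * q = 1 := by rw [hpp]; linear_combination hqr
  obtain ⟨c, hc⟩ : ∃ c, c = a * p - k * b * q := ⟨_, rfl⟩
  have hN : c ^ 2 + t * c + k = m * n * (p ^ 2 + t * p * q + k * q ^ 2) := by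
    rw [← hz, hc]
    linear_combination (-t * (a * p - k * b * q) - k * (1 + (a * q + b * p + t * b * q))) * hw
  obtain ⟨e, he⟩ : ∃ e, e = n * (p ^ 2 + t * p * q + k * q ^ 2) := ⟨_, rfl⟩
  have hN' : c ^ 2 + t * c + k = m * e := by rw [hN, he]; ring
  obtain ⟨u, v, huv⟩ := hF m (2 * c + t) e hm (by linear_combination -4 * hN')
  have hx : N t k (m * u + c * v, v) = m := by
    simp only [N]
    linear_combination v ^ 2 * hN' + m * huv
  have hxy : mu t k (m * u + c * v, v) (u * a + n * v * (p + t * q), u * b - n * v * q) = (a, b) := by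
    have hy1 : m * (u * a + n * v * (p + t * q)) =
        a * ((m * u + c * v) + t * v) + k * b * v := by
      linear_combination -v * (p + t * q) * hz - v * a * hc + v * (t * a + k * b) * hw
    have hy2 : m * (u * b - n * v * q) = b * (m * u + c * v) - a * v := by
      linear_combination v * q * hz - b * v * hc - a * v * hw
    simp only [N] at hx
    have h1 : m * (mu t k (m * u + c * v, v)
        (u * a + n * v * (p + t * q), u * b - n * v * q)).1 = m * a := by
      simp only [mu]
      linear_combination (m * u + c * v) * hy1 - k * v * hy2 + a * hx
    have h2 : m * (mu t k (m * u + c * v, v)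
        (u * a + n * v * (p + t * q), u * b - n * v * q)).2 = m * b := by
      simp only [mu]
      linear_combination (m * u + c * v) * hy2 + v * hy1 + t * v * hy2 + b * hx
    exact Prod.ext (mul_left_cancel₀ hm.ne' h1) (mul_left_cancel₀ hm.ne' h2)
  refine ⟨_, _, hx, ?_, hxy⟩
  have := N_mu t k (m * u + c * v, v) (u * a + n * v * (p + t * q), u * b - n * v * q)
  rw [hxy, hx] at this
  apply mul_left_cancel₀ hm.ne'
  rw [← this, ← hz]; simp only [N]

lemma surj (hF : ∀ A B C : ℤ, 0 < A → 4 * A * C - B ^ 2 = 4 * k - t ^ 2 →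
      ∃ u v : ℤ, A * u ^ 2 + B * u * v + C * v ^ 2 = 1)
    (m n : ℕ) (hm : 0 < m) (hn : 0 < n) (hmn : Nat.Coprime m n) (z : ℤ × ℤ)
    (hz : N t k z = m * n) :
    ∃ x y, N t k x = m ∧ N t k y = n ∧ mu t k x y = z := by
  obtain ⟨a, b⟩ := z
  have hg0 : 0 < Int.gcd a b := by
    rw [Int.gcd_pos_iff]
    by_contra hh
    push Not at hh
    obtain ⟨rfl, rfl⟩ := hh
    simp [N] at hz
    omega
  obtain ⟨g, hg⟩ : ∃ g, g = Int.gcd a b := ⟨_, rfl⟩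
  obtain ⟨a', b', hco, ha, hb⟩ := Int.exists_gcd_one hg0
  rw [← hg] at ha hb hg0
  have hzz : N t k (a, b) = g ^ 2 * N t k (a', b') := by
    simp only [N]; rw [ha, hb]; ring
  have hdvd : g ^ 2 ∣ m * n := by
    have : ((g ^ 2 : ℕ) : ℤ) ∣ ((m * n : ℕ) : ℤ) := by
      push_cast
      exact ⟨_, hz.symm.trans hzz⟩
    exact_mod_cast this
  have hgg : g = Nat.gcd g m * Nat.gcd g n := by
    rw [← hmn.gcd_mul, Nat.gcd_eq_left ((Dvd.intro_left (g ^ 1) (by ring)).trans hdvd)]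
  obtain ⟨g1, hg1⟩ : ∃ g1, g1 = Nat.gcd g m := ⟨_, rfl⟩
  obtain ⟨g2, hg2⟩ : ∃ g2, g2 = Nat.gcd g n := ⟨_, rfl⟩
  rw [← hg1, ← hg2] at hgg
  have c1 : Nat.Coprime (g1 ^ 2) n :=
    Nat.Coprime.pow_left 2 (Nat.Coprime.coprime_dvd_left (hg1 ▸ Nat.gcd_dvd_right g m) hmn)
  have c2 : Nat.Coprime (g2 ^ 2) m :=
    Nat.Coprime.pow_left 2 (Nat.Coprime.coprime_dvd_left (hg2 ▸ Nat.gcd_dvd_right g n) hmn.symm)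
  obtain ⟨m', hm'⟩ : g1 ^ 2 ∣ m := c1.dvd_of_dvd_mul_right
    ((Dvd.intro (g2 ^ 2) (by rw [hgg]; ring)).trans hdvd)
  obtain ⟨n', hn'⟩ : g2 ^ 2 ∣ n := c2.dvd_of_dvd_mul_left
    ((Dvd.intro_left (g1 ^ 2) (by rw [hgg]; ring)).trans hdvd)
  have hm'0 : 0 < m' := by
    rcases Nat.eq_zero_or_pos m' with h | h
    · subst h; simp at hm'; omega
    · exact h
  have hz' : N t k (a', b') = m' * n' := by
    have hg0' : ((g : ℤ) ^ 2) ≠ 0 := by positivity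
    apply mul_left_cancel₀ hg0'
    rw [← hzz, hz, hm', hn', hgg]; push_cast; ring
  obtain ⟨x, y, hx, hy, hxy⟩ := prim t k hF m' n' (by exact_mod_cast hm'0) (a', b') hz'
    (Int.isCoprime_iff_gcd_eq_one.mpr hco)
  refine ⟨(g1 * x.1, g1 * x.2), (g2 * y.1, g2 * y.2), ?_, ?_, ?_⟩
  · rw [hm']; push_cast; rw [← hx]; simp only [N]; ring
  · rw [hn']; push_cast; rw [← hy]; simp only [N]; ring
  · simp only [mu, Prod.mk.injEq] at hxy ⊢
    rw [ha, hb, ← hxy.1, ← hxy.2, hgg]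
    push_cast
    constructor <;> ring

lemma inj (hD : 7 ≤ 4 * k - t ^ 2) (m n : ℕ) (hm : 0 < m) (hmn : Nat.Coprime m n)
    (x y x' y' : ℤ × ℤ) (hx : N t k x = m) (hx' : N t k x' = m) (hy : N t k y = n)
    (hy' : N t k y' = n) (h : mu t k x y = mu t k x' y') :
    (x', y') = (x, y) ∨ (x', y') = (-x, -y) := by
  obtain ⟨u, v, huv⟩ := Nat.isCoprime_iff_coprime.mpr hmn
  have key : ∃ e, mu t k x e = x' := by
    refine ⟨(u * (x'.1 * (x.1 + t * x.2) + k * x'.2 * x.2) +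
      v * (y.1 * (y'.1 + t * y'.2) + k * y.2 * y'.2),
      u * (x'.2 * x.1 - x'.1 * x.2) + v * (y.2 * y'.1 - y.1 * y'.2)), ?_⟩
    simp only [mu, Prod.mk.injEq] at h
    obtain ⟨h1, h2⟩ := h
    simp only [N] at hx hy'
    ext
    · simp only [mu]
      linear_combination u * x'.1 * hx + v * x'.1 * hy' + x'.1 * huv + v * (y'.1 + t * y'.2) * h1
        + v * k * y'.2 * h2
    · simp only [mu]
      linear_combination u * x'.2 * hx + v * x'.2 * hy' + x'.2 * huv - v * y'.2 * h1
        + v * y'.1 * h2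
  obtain ⟨e, he⟩ := key
  have hNe : N t k e = 1 := by
    have := N_mu t k x e
    rw [he, hx, hx'] at this
    have hm0 : (m : ℤ) ≠ 0 := by positivity
    apply mul_left_cancel₀ hm0
    rw [← this, mul_one]
  -- cancellation by x
  have canc : ∀ w w' : ℤ × ℤ, mu t k x w = mu t k x w' → w = w' := by
    intro w w' hw
    have hm0 : (m : ℤ) ≠ 0 := by positivity
    simp only [mu, Prod.mk.injEq] at hw
    obtain ⟨h1, h2⟩ := hw
    simp only [N] at hx
    ext
    · apply mul_left_cancel₀ hm0
      rw [← hx]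
      linear_combination (x.1 + t * x.2) * h1 + k * x.2 * h2
    · apply mul_left_cancel₀ hm0
      rw [← hx]
      linear_combination - x.2 * h1 + x.1 * h2
  rcases units t k hD e hNe with rfl | rfl
  · left
    have : x' = x := by rw [← he]; ext <;> simp [mu]
    subst this
    rw [canc _ _ h]
  · right
    have : x' = -x := by rw [← he]; ext <;> simp [mu]
    subst this
    have : y = -y' := canc _ _ (by rw [h]; ext <;> simp [mu])
    rw [this, neg_neg]

lemma fin (hD : 7 ≤ 4 * k - t ^ 2) (m : ℕ) : {p : ℤ × ℤ | N t k p = m}.Finite := by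
  have hk : 0 < k := by nlinarith [sq_nonneg t]
  apply Set.Finite.subset
    (Set.Finite.prod (Set.finite_Icc (-(4 * k * m : ℤ)) (4 * k * m)) (Set.finite_Icc (-(4 * m : ℤ)) (4 * m)))
  rintro ⟨a, b⟩ h
  simp only [Set.mem_ofPred_eq, N] at h
  have hb : b ^ 2 ≤ 4 * m := by
    nlinarith [sq_nonneg (2 * a + t * b), mul_nonneg (show 0 ≤ 4 * k - t ^ 2 - 1 by omega) (sq_nonneg b)]
  have ha : a ^ 2 ≤ 4 * k * m := by
    nlinarith [sq_nonneg (2 * k * b + t * a), mul_nonneg (show 0 ≤ 4 * k - t ^ 2 - 1 by omega) (sq_nonneg a)]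
  have e1 := Int.le_self_sq |a|
  have e2 := Int.le_self_sq |b|
  rw [sq_abs] at e1 e2
  simp only [Set.mem_prod, Set.mem_Icc]
  exact ⟨abs_le.mp (by linarith), abs_le.mp (by linarith)⟩

noncomputable def S (hD : 7 ≤ 4 * k - t ^ 2) (m : ℕ) : Finset (ℤ × ℤ) := (fin t k hD m).toFinset

lemma mem_S (hD : 7 ≤ 4 * k - t ^ 2) (m : ℕ) (p : ℤ × ℤ) : p ∈ S t k hD m ↔ N t k p = m := by
  simp [S]

lemma sumW (hD : 7 ≤ 4 * k - t ^ 2) (m : ℕ) : ∑ p ∈ S t k hD m, W t p = 0 := by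
  have h : ∑ p ∈ S t k hD m, W t p = ∑ p ∈ S t k hD m, - W t p := by
    refine Finset.sum_nbij' (fun p => (p.1 + t * p.2, -p.2)) (fun p => (p.1 + t * p.2, -p.2))
      ?_ ?_ ?_ ?_ ?_
    · intro p hp
      rw [mem_S] at hp ⊢
      rw [← hp]; simp only [N]; ring
    · intro p hp
      rw [mem_S] at hp ⊢
      rw [← hp]; simp only [N]; ring
    · intro p _; ext <;> simp
    · intro p _; ext <;> simp
    · intro p _; simp only [W]; push_cast; ring
  rw [Finset.sum_neg_distrib] at h
  linarith

lemma mult (hD : 7 ≤ 4 * k - t ^ 2)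
    (hF : ∀ A B C : ℤ, 0 < A → 4 * A * C - B ^ 2 = 4 * k - t ^ 2 →
      ∃ u v : ℤ, A * u ^ 2 + B * u * v + C * v ^ 2 = 1)
    (m n : ℕ) (hm : 0 < m) (hn : 0 < n) (hmn : Nat.Coprime m n) :
    (∑ p ∈ S t k hD m, V t k p) * (∑ p ∈ S t k hD n, V t k p)
      = 2 * ∑ p ∈ S t k hD (m * n), V t k p := by
  have h1 : (∑ p ∈ S t k hD m, V t k p) * (∑ p ∈ S t k hD n, V t k p)
      = ∑ q ∈ S t k hD m ×ˢ S t k hD n, V t k (mu t k q.1 q.2) := by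
    simp only [V_mu]
    rw [Finset.sum_sub_distrib, ← Finset.mul_sum, Finset.sum_product, Finset.sum_product,
      ← Finset.sum_mul_sum, ← Finset.sum_mul_sum, sumW]
    ring
  rw [h1, ← Finset.sum_fiberwise_of_maps_to (t := S t k hD (m * n)) (g := fun q => mu t k q.1 q.2),
    Finset.mul_sum]
  · apply Finset.sum_congr rfl
    intro z hz
    rw [Finset.sum_congr rfl (g := fun _ => V t k z)
      (fun q hq => by rw [(Finset.mem_filter.mp hq).2]), Finset.sum_const]
    rw [mem_S] at hz
    obtain ⟨x, y, hx, hy, hxy⟩ := surj t k hF m n hm hn hmn z (by rw [hz]; push_cast; rfl)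
    have : (S t k hD m ×ˢ S t k hD n).filter (fun q => mu t k q.1 q.2 = z)
        = {(x, y), (-x, -y)} := by
      ext ⟨x', y'⟩
      simp only [Finset.mem_filter, Finset.mem_product, mem_S, Finset.mem_insert,
        Finset.mem_singleton]
      constructor
      · rintro ⟨⟨a1, a2⟩, a3⟩
        exact inj t k hD m n hm hmn x y x' y' hx a1 hy a2 (hxy.trans a3.symm)
      · rintro (h | h)
        · obtain ⟨rfl, rfl⟩ := Prod.mk.inj h
          exact ⟨⟨hx, hy⟩, hxy⟩
        · obtain ⟨rfl, rfl⟩ := Prod.mk.inj h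
          refine ⟨⟨?_, ?_⟩, ?_⟩
          · rw [← hx]; simp only [N, Prod.fst_neg, Prod.snd_neg]; ring
          · rw [← hy]; simp only [N, Prod.fst_neg, Prod.snd_neg]; ring
          · rw [← hxy]; simp only [mu, Prod.fst_neg, Prod.snd_neg]; ext <;> simp
    rw [this, Finset.card_pair]
    · simp
    · intro h
      have h3 : x = -x := (Prod.mk.inj h).1
      have h4 : x.1 = 0 := by have := congrArg Prod.fst h3; simp at this; omega
      have h5 : x.2 = 0 := by have := congrArg Prod.snd h3; simp at this; omega
      simp [N, h4, h5] at hx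
      omega
  · intro q hq
    rw [Finset.mem_product, mem_S, mem_S] at hq
    rw [mem_S, N_mu, hq.1, hq.2]; push_cast; rfl

lemma main (hD : 7 ≤ 4 * k - t ^ 2)
    (hred : ∀ A B C : ℤ, 0 < A → -A ≤ B → B ≤ A → A ≤ C → 4 * A * C - B ^ 2 = 4 * k - t ^ 2 →
      A = 1) (d : ℕ) (hQ : ∀ p, Qf d p = N t k p) (hV : ∀ p, Vf d p = V t k p)
    (b : ℕ → ℚ) (hb : ∀ m, 0 < m → b m = (1 / 2) * ∑ᶠ p ∈ shell d m, Vf d p) :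
    b 1 = 1 ∧ ∀ m n : ℕ, 0 < m → 0 < n → Nat.Coprime m n → b (m * n) = b m * b n := by
  have hb' : ∀ m, 0 < m → b m = (1 / 2) * ∑ p ∈ S t k hD m, V t k p := by
    intro m hm
    rw [hb m hm, finsum_mem_eq_finite_toFinset_sum _ (s := shell d m)
      (by simpa only [shell, hQ] using fin t k hD m)]
    congr 1
    refine Finset.sum_congr ?_ (fun p _ => hV p)
    ext p
    simp [mem_S, shell, hQ]
  constructor
  · rw [hb' 1 one_pos]
    have : S t k hD 1 = {(1, 0), (-1, 0)} := by
      ext p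
      rw [mem_S, Finset.mem_insert, Finset.mem_singleton]
      constructor
      · intro h; exact units t k hD p (by simpa using h)
      · rintro (rfl | rfl) <;> simp [N]
    rw [this, Finset.sum_pair (by decide)]
    simp [V]; norm_num
  · intro m n hm hn hmn
    rw [hb' _ (Nat.mul_pos hm hn), hb' m hm, hb' n hn]
    have := mult t k hD (fun A B C hA h => form_one _ hred (by omega) _ A B C rfl hA h) m n hm hn hmn
    linear_combination - (1 / 4) * this
end

lemma red (D : ℤ) (hD : D = 8 ∨ D = 7 ∨ D = 11 ∨ D = 19 ∨ D = 43 ∨ D = 67 ∨ D = 163)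
    (A B C : ℤ) (hA : 0 < A) (h1 : -A ≤ B) (h2 : B ≤ A) (h3 : A ≤ C)
    (h : 4 * A * C - B ^ 2 = D) : A = 1 := by
  have hA7 : A ≤ 7 := by
    have : D ≤ 163 := by omega
    have h5 : B ^ 2 ≤ A ^ 2 := sq_le_sq' h1 h2
    nlinarith [mul_le_mul_of_nonneg_left h3 hA.le]
  interval_cases A
  · rfl
  all_goals
    exfalso
    interval_cases B <;> omega

end Aux14

/-- For `d ∈ {2, 7, 11, 19, 43, 67, 163}`, the function
`b_d(m) = (1/2)·∑_{(a,b) ∈ S_d(m)} V_d(a,b)` on positive integers satisfies `b_d(1) = 1`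
and `b_d(m·n) = b_d(m)·b_d(n)` for all coprime positive integers `m` and `n`. -/
theorem stmt_14 (d : ℕ) (hd : d ∈ ({2, 7, 11, 19, 43, 67, 163} : Finset ℕ))
    (b : ℕ → ℚ) (hb : ∀ m, 0 < m → b m = (1 / 2) * ∑ᶠ p ∈ shell d m, Vf d p) :
    b 1 = 1 ∧ ∀ m n : ℕ, 0 < m → 0 < n → Nat.Coprime m n → b (m * n) = b m * b n := by
  simp only [Finset.mem_insert, Finset.mem_singleton] at hd
  by_cases h2 : d = 2
  · subst h2
    refine Aux14.main 0 2 (by norm_num) (Aux14.red _ (by norm_num)) 2 ?_ ?_ b hb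
    · intro p; simp [Qf, Aux14.N]
    · intro p; simp [Vf, Aux14.V]; ring
  · obtain ⟨k, hk⟩ : ∃ k : ℕ, d + 1 = 4 * k := ⟨(d + 1) / 4, by omega⟩
    have hd3 : d % 4 = 3 := by omega
    have hk' : (1 + d) / 4 = k := by omega
    have hkq : (d : ℚ) = 4 * k - 1 := by
      have : ((d + 1 : ℕ) : ℚ) = ((4 * k : ℕ) : ℚ) := by rw [hk]
      push_cast at this
      linarith
    refine Aux14.main 1 k (by omega) (Aux14.red _ (by omega)) d ?_ ?_ b hb
    · intro p; simp [Qf, Aux14.N, hd3, hk']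
    · intro p; simp [Vf, Aux14.V, hd3, hkq]; ring
end

section
/- Let d ∈ {2, 7, 11, 19, 43, 67, 163}, and define b_d : {positive integers} → ℚ by b_d(m) = (1/2)·∑_{(a,b) ∈ S_d(m)} V_d(a,b). Then for every prime p such that either p is odd and the Legendre symbol (d_K/p) = 1, or p = 2 and d_K ≡ 1 (mod 8), and for every integer α ≥ 1, one has b_d(p^{α+1}) = b_d(p)·b_d(p^α) − p²·b_d(p^{α−1}). -/
theorem hk_descent (t n : ℤ) (hD : 0 < 4 * n - t ^ 2)
    (hred : ∀ A B C : ℤ, 2 ≤ A → |B| ≤ A → A ≤ C → B ^ 2 - 4 * A * C = t ^ 2 - 4 * n → False) :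
    ∀ (N : ℕ) (A B C : ℤ), 0 < A → A ≤ N → B ^ 2 - 4 * A * C = t ^ 2 - 4 * n →
      ∃ u v w s : ℤ, A = u ^ 2 + t * u * v + n * v ^ 2 ∧ C = w ^ 2 + t * w * s + n * s ^ 2 ∧
        B = 2 * u * w + t * (u * s + v * w) + 2 * n * v * s := by
  intro N
  induction N with
  | zero => intro A B C h1 h2; push_cast at h2; omega
  | succ N ih =>
    intro A B C hA hAN hdisc
    -- a shift
    have shift : ∀ k : ℤ, (∃ u v w s : ℤ, A = u ^ 2 + t * u * v + n * v ^ 2 ∧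
        C + k * B + k ^ 2 * A = w ^ 2 + t * w * s + n * s ^ 2 ∧
        B + 2 * k * A = 2 * u * w + t * (u * s + v * w) + 2 * n * v * s) →
        ∃ u v w s : ℤ, A = u ^ 2 + t * u * v + n * v ^ 2 ∧ C = w ^ 2 + t * w * s + n * s ^ 2 ∧
        B = 2 * u * w + t * (u * s + v * w) + 2 * n * v * s := by
      rintro k ⟨u, v, w, s, h1, h2, h3⟩
      refine ⟨u, v, w - k * u, s - k * v, h1, ?_, ?_⟩
      · linear_combination h2 - k * h3 + k ^ 2 * h1
      · linear_combination h3 - 2 * k * h1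
    by_cases hA1 : A = 1
    · subst hA1
      have hpar : ∃ k, t = B + 2 * k := by
        have h2 : (2 : ℤ) ∣ (t - B) * (t + B) :=
          ⟨2 * n - 2 * C, by linear_combination -hdisc⟩
        rcases Int.prime_two.dvd_or_dvd h2 with ⟨k, hk⟩ | ⟨k, hk⟩
        · exact ⟨k, by linarith⟩
        · exact ⟨k - B, by linarith⟩
      obtain ⟨k, hk⟩ := hpar
      apply shift k
      refine ⟨1, 0, 0, 1, by ring, ?_, by linarith⟩
      have : 4 * (C + k * B + k ^ 2 * 1) = 4 * n := by
        subst hk; linarith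
      linarith
    · obtain ⟨k, hk⟩ : ∃ k : ℤ, |B + 2 * k * A| ≤ A := by
        refine ⟨-((B + A) / (2 * A)), ?_⟩
        have e := Int.emod_add_mul_ediv (B + A) (2 * A)
        have l := Int.emod_nonneg (B + A) (b := 2 * A) (by omega)
        have g := Int.emod_lt_of_pos (B + A) (b := 2 * A) (by omega)
        rw [abs_le]
        constructor <;> linarith
      apply shift k
      have hd' : (B + 2 * k * A) ^ 2 - 4 * A * (C + k * B + k ^ 2 * A) = t ^ 2 - 4 * n := by
        linarith
      generalize B + 2 * k * A = B' at *
      generalize C + k * B + k ^ 2 * A = C' at *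
      by_cases hC : A ≤ C'
      · exact (hred A B' C' (by omega) hk hC hd').elim
      · have hC0 : 0 < C' := by
          have : 0 < 4 * A * C' := by nlinarith [sq_nonneg B']
          exact pos_of_mul_pos_right this (by omega)
        obtain ⟨u, v, w, s, h1, h2, h3⟩ := ih C' (-B') A hC0 (by push_cast at hAN; omega)
          (by linarith)
        exact ⟨w, s, -u, -v, h2, by linarith, by linarith⟩

/-- norm form -/
def hkN (t n : ℤ) (z : ℤ × ℤ) : ℤ := z.1 ^ 2 + t * z.1 * z.2 + n * z.2 ^ 2

/-- multiplication -/
def hkM (t n : ℤ) (x z : ℤ × ℤ) : ℤ × ℤ :=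
  (x.1 * z.1 - n * x.2 * z.2, x.1 * z.2 + x.2 * z.1 + t * x.2 * z.2)

/-- conjugation -/
def hkc (t : ℤ) (x : ℤ × ℤ) : ℤ × ℤ := (x.1 + t * x.2, -x.2)

/-- the harmonic polynomial -/
def hkV (t n : ℤ) (z : ℤ × ℤ) : ℚ :=
  ((2 * (z.1 : ℚ) + t * z.2) ^ 2 - (4 * n - t ^ 2) * (z.2 : ℚ) ^ 2) / 4

/-- shells -/
def hkS (t n m : ℤ) : Set (ℤ × ℤ) := {z | hkN t n z = m}

theorem hkN_mul (t n : ℤ) (x z : ℤ × ℤ) : hkN t n (hkM t n x z) = hkN t n x * hkN t n z := by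
  simp only [hkN, hkM]; ring

theorem hkN_conj (t n : ℤ) (x : ℤ × ℤ) : hkN t n (hkc t x) = hkN t n x := by
  simp only [hkN, hkc]; ring

theorem hkcc (t : ℤ) (x : ℤ × ℤ) : hkc t (hkc t x) = x := by
  ext <;> simp [hkc]

theorem hkM_conj (t n : ℤ) (x z : ℤ × ℤ) :
    hkM t n (hkc t x) (hkM t n x z) = (hkN t n x * z.1, hkN t n x * z.2) := by
  ext <;> simp only [hkN, hkM, hkc] <;> ring

theorem hkM_conj' (t n : ℤ) (x z : ℤ × ℤ) :
    hkM t n x (hkM t n (hkc t x) z) = (hkN t n x * z.1, hkN t n x * z.2) := by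
  ext <;> simp only [hkN, hkM, hkc] <;> ring

theorem hkM_inj (t n : ℤ) (x : ℤ × ℤ) (hx : hkN t n x ≠ 0) :
    Function.Injective (hkM t n x) := by
  intro z w h
  have h1 := hkM_conj t n x z
  rw [h, hkM_conj] at h1
  simp only [Prod.mk.injEq] at h1
  ext
  · exact (mul_left_cancel₀ hx h1.1).symm
  · exact (mul_left_cancel₀ hx h1.2).symm

theorem hk_half (t n : ℤ) (p : ℕ) (hp : p.Prime) (x z : ℤ × ℤ) (hx : hkN t n x = p)
    (hz : (p : ℤ) ∣ hkN t n z) (h2 : (p : ℤ) ∣ (hkM t n (hkc t x) z).2) :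
    ∃ w, z = hkM t n x w := by
  have hpp : Prime (p : ℤ) := Nat.prime_iff_prime_int.mp hp
  have hN : hkN t n (hkM t n (hkc t x) z) = p * hkN t n z := by
    rw [hkN_mul, hkN_conj, hx]
  have hm := hkM_conj' t n x z
  rw [hx] at hm
  generalize hkM t n (hkc t x) z = y at *
  obtain ⟨y1, y2⟩ := y
  obtain ⟨b, hb⟩ := h2
  simp only at hb
  subst hb
  have h1 : (p : ℤ) ∣ y1 := by
    apply hpp.dvd_of_dvd_pow (n := 2)
    refine ⟨hkN t n z - t * y1 * b - n * p * b ^ 2, ?_⟩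
    simp only [hkN] at hN ⊢
    linear_combination hN
  obtain ⟨a, ha⟩ := h1
  subst ha
  refine ⟨(a, b), ?_⟩
  have hp0 : (p : ℤ) ≠ 0 := hpp.ne_zero
  simp only [hkM, Prod.mk.injEq] at hm
  ext
  · apply mul_left_cancel₀ hp0
    simp only [hkM]; linear_combination -hm.1
  · apply mul_left_cancel₀ hp0
    simp only [hkM]; linear_combination -hm.2

theorem hk_cover (t n : ℤ) (p : ℕ) (hp : p.Prime) (x z : ℤ × ℤ) (hx : hkN t n x = p)
    (hz : (p : ℤ) ∣ hkN t n z) :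
    (∃ w, z = hkM t n x w) ∨ (∃ w, z = hkM t n (hkc t x) w) := by
  have hpp : Prime (p : ℤ) := Nat.prime_iff_prime_int.mp hp
  have : (p : ℤ) ∣ (hkM t n (hkc t x) z).2 * (hkM t n x z).2 := by
    obtain ⟨k, hk⟩ := hz
    refine ⟨z.2 ^ 2 - x.2 ^ 2 * k, ?_⟩
    simp only [hkN, hkM, hkc] at *
    linear_combination z.2 ^ 2 * hx - x.2 ^ 2 * hk
  rcases hpp.dvd_or_dvd this with h | h
  · exact Or.inl (hk_half t n p hp x z hx hz h)
  · right
    refine hk_half t n p hp (hkc t x) z (by rw [hkN_conj, hx]) hz ?_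
    rwa [hkcc]

theorem hk_inter (t n : ℤ) (p : ℕ) (hp : p.Prime) (x z w w' : ℤ × ℤ) (hx : hkN t n x = p)
    (hD : ¬ (p : ℤ) ∣ 4 * n - t ^ 2)
    (h1 : z = hkM t n x w) (h2 : z = hkM t n (hkc t x) w') :
    ∃ y : ℤ × ℤ, z = (p * y.1, p * y.2) := by
  have hpp : Prime (p : ℤ) := Nat.prime_iff_prime_int.mp hp
  have hT : ¬ (p : ℤ) ∣ 2 * x.1 + t * x.2 := by
    rintro ⟨k, hk⟩
    have h3 : (p : ℤ) ∣ (4 * n - t ^ 2) * x.2 ^ 2 := by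
      refine ⟨4 - p * k ^ 2, ?_⟩
      simp only [hkN] at hx
      linear_combination 4 * hx - (2 * x.1 + t * x.2 + p * k) * hk
    have h4 : (p : ℤ) ∣ x.2 := hpp.dvd_of_dvd_pow ((hpp.dvd_or_dvd h3).resolve_left hD)
    obtain ⟨v, hv⟩ := h4
    have h5 : (p : ℤ) ∣ x.1 := by
      apply hpp.dvd_of_dvd_pow (n := 2)
      refine ⟨1 - t * x.1 * v - n * p * v ^ 2, ?_⟩
      simp only [hkN, hv] at hx
      linear_combination hx
    obtain ⟨u, hu⟩ := h5
    simp only [hkN, hv, hu] at hx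
    have h6 : (p : ℤ) * (p * (u ^ 2 + t * u * v + n * v ^ 2)) = p * 1 := by
      linear_combination hx
    have h7 := mul_left_cancel₀ hpp.ne_zero h6
    exact hpp.not_isUnit (IsUnit.of_mul_eq_one _ h7)
  -- trace(x) * z = p * (w + w')
  have e := hkM_conj' t n x w'
  have e' := hkM_conj t n x w
  rw [← h2, hx] at e
  rw [← h1, hx] at e'
  simp only [hkM, hkc, Prod.mk.injEq] at e e'
  have d1 : (p : ℤ) ∣ z.1 := by
    refine (hpp.dvd_or_dvd (a := 2 * x.1 + t * x.2) ⟨w.1 + w'.1, ?_⟩).resolve_left hT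
    linear_combination e.1 + e'.1
  have d2 : (p : ℤ) ∣ z.2 := by
    refine (hpp.dvd_or_dvd (a := 2 * x.1 + t * x.2) ⟨w.2 + w'.2, ?_⟩).resolve_left hT
    linear_combination e.2 + e'.2
  obtain ⟨a, ha⟩ := d1
  obtain ⟨b, hb⟩ := d2
  exact ⟨(a, b), Prod.ext ha hb⟩

theorem hkS_finite (t n m : ℤ) (hD : 0 < 4 * n - t ^ 2) : (hkS t n m).Finite := by
  have hinj : Set.InjOn (fun z : ℤ × ℤ => (2 * z.1 + t * z.2, z.2)) (hkS t n m) := by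
    rintro ⟨a, b⟩ _ ⟨c, e⟩ _ h
    simp only [Prod.mk.injEq] at h
    obtain ⟨h1, h2⟩ := h
    subst h2
    ext <;> simp; linarith
  refine Set.Finite.of_finite_image ?_ hinj
  refine (((Set.finite_Icc (-(4 * m)) (4 * m)).prod (Set.finite_Icc (-(4 * m)) (4 * m)))).subset ?_
  rintro _ ⟨⟨a, b⟩, hz, rfl⟩
  simp only [hkS, hkN, Set.mem_ofPred_eq] at hz
  have key : (2 * a + t * b) ^ 2 + (4 * n - t ^ 2) * b ^ 2 = 4 * m := by linear_combination 4 * hz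
  have hb : b ^ 2 ≤ (4 * n - t ^ 2) * b ^ 2 := by nlinarith [sq_nonneg b]
  have aux : ∀ y : ℤ, y ^ 2 ≤ 4 * m → y ∈ Set.Icc (-(4 * m)) (4 * m) := by
    intro y hy
    have h3 : |y| ≤ y ^ 2 := by
      rcases eq_or_ne y 0 with rfl | h0
      · simp
      · have := Int.one_le_abs h0
        rw [← sq_abs]; nlinarith
    rw [Set.mem_Icc, ← abs_le]
    linarith
  refine ⟨aux _ ?_, aux _ ?_⟩
  · have := sq_nonneg b
    simp only; linarith
  · have := sq_nonneg (2 * a + t * b)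
    simp only; linarith

theorem hkV_conj (t n : ℤ) (x z : ℤ × ℤ) :
    hkV t n (hkM t n x z) + hkV t n (hkM t n (hkc t x) z) = 2 * hkV t n x * hkV t n z := by
  simp only [hkV, hkM, hkc]; push_cast; ring

theorem hk_rec (t n : ℤ) (hD : 0 < 4 * n - t ^ 2) (p : ℕ) (hp : p.Prime) (x : ℤ × ℤ)
    (hx : hkN t n x = p) (hpD : ¬ (p : ℤ) ∣ 4 * n - t ^ 2) (m : ℤ) :
    ∑ᶠ z ∈ hkS t n (p * m), hkV t n z +
      ∑ᶠ z ∈ (fun y : ℤ × ℤ => ((p * y.1, p * y.2) : ℤ × ℤ)) '' {y | p * hkN t n y = m},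
        hkV t n z = 2 * hkV t n x * ∑ᶠ z ∈ hkS t n m, hkV t n z := by
  have hp0 : (p : ℤ) ≠ 0 := by exact_mod_cast hp.ne_zero
  have hx' : hkN t n (hkc t x) = p := by rw [hkN_conj, hx]
  have hi := hkM_inj t n x (by rw [hx]; exact hp0)
  have hi' := hkM_inj t n (hkc t x) (by rw [hx']; exact hp0)
  have hU : hkS t n (p * m) = hkM t n x '' hkS t n m ∪ hkM t n (hkc t x) '' hkS t n m := by
    ext z
    constructor
    · intro hz
      simp only [hkS, Set.mem_ofPred_eq] at hz
      rcases hk_cover t n p hp x z hx ⟨m, hz⟩ with ⟨w, rfl⟩ | ⟨w, rfl⟩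
      · left
        rw [hkN_mul, hx] at hz
        exact ⟨w, mul_left_cancel₀ hp0 hz, rfl⟩
      · right
        rw [hkN_mul, hx'] at hz
        exact ⟨w, mul_left_cancel₀ hp0 hz, rfl⟩
    · rintro (⟨w, hw, rfl⟩ | ⟨w, hw, rfl⟩) <;> simp only [hkS, Set.mem_ofPred_eq] at hw ⊢
      · rw [hkN_mul, hx, hw]
      · rw [hkN_mul, hx', hw]
  have hI : (fun y : ℤ × ℤ => ((p * y.1, p * y.2) : ℤ × ℤ)) '' {y | p * hkN t n y = m} =
      hkM t n x '' hkS t n m ∩ hkM t n (hkc t x) '' hkS t n m := by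
    ext z
    constructor
    · rintro ⟨y, hy, rfl⟩
      simp only [Set.mem_ofPred_eq] at hy
      constructor
      · refine ⟨hkM t n (hkc t x) y, ?_, ?_⟩
        · simp only [hkS, Set.mem_ofPred_eq]
          rw [hkN_mul, hx', hy]
        · rw [hkM_conj', hx]
      · refine ⟨hkM t n x y, ?_, ?_⟩
        · simp only [hkS, Set.mem_ofPred_eq]
          rw [hkN_mul, hx, hy]
        · rw [hkM_conj, hx]
    · rintro ⟨⟨w, hw, h1⟩, ⟨w', hw', h2⟩⟩
      obtain ⟨y, hy⟩ := hk_inter t n p hp x z w w' hx hpD h1.symm h2.symm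
      refine ⟨y, ?_, hy.symm⟩
      simp only [hkS, Set.mem_ofPred_eq] at hw ⊢
      have h3 : hkN t n z = p * m := by rw [← h1, hkN_mul, hx, hw]
      rw [hy] at h3
      apply mul_left_cancel₀ hp0
      rw [← h3]
      simp only [hkN]; ring
  have hf := hkS_finite t n m hD
  rw [hU, hI, finsum_mem_union_inter (hf.image _) (hf.image _),
    finsum_mem_image hi.injOn, finsum_mem_image hi'.injOn, ← finsum_mem_add_distrib hf,
    mul_finsum_mem (hkV t n) (2 * hkV t n x)]
  exact finsum_mem_congr rfl fun z _ => hkV_conj t n x z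

theorem hkS_one (t n : ℤ) (hD : 4 < 4 * n - t ^ 2) : hkS t n 1 = {(1, 0), (-1, 0)} := by
  ext ⟨a, b⟩
  simp only [hkS, hkN, Set.mem_ofPred_eq, Set.mem_insert_iff, Set.mem_singleton_iff,
    Prod.mk.injEq]
  constructor
  · intro h
    have key : (2 * a + t * b) ^ 2 + (4 * n - t ^ 2) * b ^ 2 = 4 := by linear_combination 4 * h
    have hb : b = 0 := by
      by_contra hb
      have : 0 < b ^ 2 := by positivity
      nlinarith [sq_nonneg (2 * a + t * b)]
    subst hb
    have : a ^ 2 = 1 := by linarith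
    rcases (sq_eq_sq_iff_eq_or_eq_neg.mp (this.trans (one_pow 2).symm)) with h | h <;> simp [h]
  · rintro (⟨rfl, rfl⟩ | ⟨rfl, rfl⟩) <;> ring

theorem hk_main (t n : ℤ) (hD : 4 < 4 * n - t ^ 2) (p : ℕ) (hp : p.Prime) (x : ℤ × ℤ)
    (hx : hkN t n x = p) (hpD : ¬ (p : ℤ) ∣ 4 * n - t ^ 2) (c : ℕ → ℚ)
    (hc : ∀ m : ℕ, 0 < m → c m = (1 / 2) * ∑ᶠ z ∈ hkS t n m, hkV t n z) (k : ℕ) :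
    c (p ^ (k + 2)) = c p * c (p ^ (k + 1)) - (p : ℚ) ^ 2 * c (p ^ k) := by
  have hp0 : (p : ℤ) ≠ 0 := by exact_mod_cast hp.ne_zero
  have hpos := hp.pos
  have h1 : c p = 2 * hkV t n x := by
    have h := hk_rec t n (by linarith) p hp x hx hpD 1
    have hem : {y : ℤ × ℤ | p * hkN t n y = 1} = ∅ := by
      ext y
      simp only [Set.mem_ofPred_eq, Set.mem_empty_iff_false, iff_false]
      intro h
      exact (Nat.prime_iff_prime_int.mp hp).not_isUnit (IsUnit.of_mul_eq_one _ h)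
    rw [hem, Set.image_empty, finsum_mem_empty, add_zero, mul_one, hkS_one t n hD,
      finsum_mem_pair (by simp)] at h
    rw [hc p hpos, h]
    simp only [hkV]; push_cast; ring
  have h := hk_rec t n (by linarith) p hp x hx hpD (p ^ (k + 1))
  have hset : {y : ℤ × ℤ | p * hkN t n y = (p : ℤ) ^ (k + 1)} = hkS t n (p ^ k) := by
    ext y
    simp only [Set.mem_ofPred_eq, hkS]
    rw [pow_succ', mul_right_inj' hp0]
  have hinj : Function.Injective (fun y : ℤ × ℤ => ((p * y.1, p * y.2) : ℤ × ℤ)) := by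
    intro y y' h
    simp only [Prod.mk.injEq] at h
    exact Prod.ext (mul_left_cancel₀ hp0 h.1) (mul_left_cancel₀ hp0 h.2)
  have hV : ∀ y : ℤ × ℤ, hkV t n (p * y.1, p * y.2) = (p : ℚ) ^ 2 * hkV t n y := by
    intro y; simp only [hkV]; push_cast; ring
  rw [hset, finsum_mem_image hinj.injOn, finsum_mem_congr rfl (fun y _ => hV y),
    ← mul_finsum_mem (hkV t n) ((p : ℚ) ^ 2), ← pow_succ'] at h
  rw [h1, hc _ (pow_pos hpos _), hc _ (pow_pos hpos _), hc _ (pow_pos hpos _)]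
  push_cast
  linear_combination (1 / 2) * h

theorem hk_full (t n : ℤ) (hD : 4 < 4 * n - t ^ 2)
    (hred : ∀ A ∈ Finset.Icc (2 : ℤ) 7, ∀ B ∈ Finset.Icc (-A) A,
      (B ^ 2 + (4 * n - t ^ 2)) % (4 * A) = 0 → B ^ 2 + (4 * n - t ^ 2) < 4 * A ^ 2)
    (hD2 : 4 * n - t ^ 2 ≤ 163) (D : ℤ) (hDD : D = t ^ 2 - 4 * n)
    (hodd : D % 8 = 1 → t = 1 ∧ n % 2 = 0)
    (p : ℕ) [hp : Fact p.Prime]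
    (hsplit : (p ≠ 2 ∧ legendreSym p D = 1) ∨ (p = 2 ∧ D % 8 = 1))
    (c : ℕ → ℚ)
    (hc : ∀ m : ℕ, 0 < m → c m = (1 / 2) * ∑ᶠ z ∈ hkS t n m, hkV t n z) (α : ℕ) (hα : 1 ≤ α) :
    c (p ^ (α + 1)) = c p * c (p ^ α) - (p : ℚ) ^ 2 * c (p ^ (α - 1)) := by
  obtain ⟨k, rfl⟩ : ∃ k, α = k + 1 := ⟨α - 1, by omega⟩
  have hpp : Prime (p : ℤ) := Nat.prime_iff_prime_int.mp hp.out
  have hpD : ¬ (p : ℤ) ∣ 4 * n - t ^ 2 := by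
    intro h
    have h' : (p : ℤ) ∣ D := by rw [hDD, ← dvd_neg]; simpa using h
    rcases hsplit with ⟨-, hl⟩ | ⟨h2, h8⟩
    · have := (legendreSym.eq_zero_iff p D).mpr ((ZMod.intCast_zmod_eq_zero_iff_dvd D p).mpr h')
      omega
    · subst h2; push_cast at h'; omega
  have hr : ∃ r : ℤ, (p : ℤ) ∣ r ^ 2 + t * r + n := by
    rcases hsplit with ⟨hp2, hl⟩ | ⟨h2, h8⟩
    · have hD0 : (D : ZMod p) ≠ 0 := by
        intro h0
        rw [(legendreSym.eq_zero_iff p D).mpr h0] at hl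
        omega
      obtain ⟨y, hy⟩ := (legendreSym.eq_one_iff p hD0).mp hl
      obtain ⟨s, rfl⟩ := ZMod.intCast_surjective y
      have hs : (p : ℤ) ∣ D - s * s := by
        rw [← ZMod.intCast_zmod_eq_zero_iff_dvd]; push_cast; rw [hy, sub_self]
      have hpo : (p : ℤ) % 2 = 1 := by
        have := hp.out.eq_two_or_odd; omega
      -- 2r + t = s mod p
      obtain ⟨q, hq⟩ : ∃ q : ℤ, (p : ℤ) = 2 * q + 1 := ⟨p / 2, by omega⟩
      refine ⟨(s - t) * (q + 1), ?_⟩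
      obtain ⟨e, he⟩ := hs
      have h4 : (p : ℤ) ∣ 2 ^ 2 * (((s - t) * (q + 1)) ^ 2 + t * ((s - t) * (q + 1)) + n) := by
        have hz : 2 * ((s - t) * (q + 1)) + t = s + p * (s - t) := by rw [hq]; ring
        refine ⟨2 * s * (s - t) + p * (s - t) ^ 2 - e, ?_⟩
        linear_combination (2 * ((s - t) * (q + 1)) + t + s + p * (s - t)) * hz - he + hDD
      refine (hpp.dvd_or_dvd h4).resolve_left fun h => ?_
      have := Int.le_of_dvd (by norm_num) (hpp.dvd_of_dvd_pow h)
      have := hp.out.two_le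
      omega
    · obtain ⟨_, hn⟩ := hodd h8
      refine ⟨0, ?_⟩
      subst h2
      push_cast; simp; omega
  obtain ⟨r, C, hC⟩ := hr
  obtain ⟨u, v, _, _, hu, _⟩ := hk_descent t n (by linarith) (by
    intro A B C h2 hB hAC hd
    have hA0 : 0 < A := by linarith
    have hBB : B ^ 2 ≤ A ^ 2 := sq_le_sq.mpr (by rwa [abs_of_pos hA0])
    have hCA : A ^ 2 ≤ A * C := by nlinarith
    have hA7 : A ≤ 7 := by nlinarith
    have := hred A (Finset.mem_Icc.mpr ⟨h2, hA7⟩) B (Finset.mem_Icc.mpr (abs_le.mp hB))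
      (Int.emod_eq_zero_of_dvd ⟨C, by linarith⟩)
    linarith) p p (2 * r + t) C (by exact_mod_cast hp.out.pos) le_rfl
      (by linear_combination 4 * hC)
  exact hk_main t n hD p hp.out (u, v) (by simp only [hkN]; exact hu.symm) hpD c hc k

theorem hk_shell3 (d m : ℕ) (n : ℕ) (hd : d + 1 = 4 * n) : shell d m = hkS 1 n m := by
  have h3 : d % 4 = 3 := by omega
  have h4 : (1 + d) / 4 = n := by omega
  ext z
  simp [shell, Qf, hkS, hkN, h3, h4]

theorem hk_V3 (d : ℕ) (n : ℕ) (hd : d + 1 = 4 * n) : Vf d = hkV 1 n := by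
  have h3 : d % 4 = 3 := by omega
  have h4 : (d : ℚ) = 4 * n - 1 := by
    have : (d : ℚ) + 1 = 4 * n := by exact_mod_cast hd
    linarith
  ext z
  simp [Vf, hkV, h3, h4]

/-- For `d ∈ {2, 7, 11, 19, 43, 67, 163}`, the function
`b_d(m) = (1/2)·∑_{(a,b) ∈ S_d(m)} V_d(a,b)` satisfies, for every prime `p` such that
either `p` is odd and `(d_K/p) = 1`, or `p = 2` and `d_K ≡ 1 (mod 8)`, and every `α ≥ 1`,
the Hecke recurrence `b_d(p^{α+1}) = b_d(p)·b_d(p^α) − p²·b_d(p^{α−1})`. -/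
theorem stmt_15 (d : ℕ) (hd : d ∈ ({2, 7, 11, 19, 43, 67, 163} : Finset ℕ))
    (b : ℕ → ℚ) (hb : ∀ m, 0 < m → b m = (1 / 2) * ∑ᶠ p ∈ shell d m, Vf d p)
    (p : ℕ) [hp : Fact p.Prime]
    (hsplit : (p ≠ 2 ∧ legendreSym p (discK d) = 1) ∨ (p = 2 ∧ discK d % 8 = 1))
    (α : ℕ) (hα : 1 ≤ α) :
    b (p ^ (α + 1)) = b p * b (p ^ α) - (p : ℚ) ^ 2 * b (p ^ (α - 1)) := by
  have key : ∀ n : ℕ, d + 1 = 4 * n → (4 : ℤ) < 4 * n - 1 ^ 2 →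
      (∀ A ∈ Finset.Icc (2 : ℤ) 7, ∀ B ∈ Finset.Icc (-A) A,
      (B ^ 2 + (4 * (n : ℤ) - 1 ^ 2)) % (4 * A) = 0 →
        B ^ 2 + (4 * (n : ℤ) - 1 ^ 2) < 4 * A ^ 2) →
      b (p ^ (α + 1)) = b p * b (p ^ α) - (p : ℚ) ^ 2 * b (p ^ (α - 1)) := by
    intro n hn h4 hred
    have hdle : d ≤ 163 := by
      simp only [Finset.mem_insert, Finset.mem_singleton] at hd; omega
    have hdisc : discK d = -(d : ℤ) := by
      have h3 : d % 4 = 3 := by omega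
      simp [discK, h3]
    refine hk_full 1 n h4 hred (by omega) (discK d) (by rw [hdisc]; omega)
      (by rw [hdisc]; omega) p hsplit b ?_ α hα
    intro m hm
    rw [hb m hm, hk_shell3 d m n hn, hk_V3 d n hn]
  simp only [Finset.mem_insert, Finset.mem_singleton] at hd
  rcases hd with rfl | rfl | rfl | rfl | rfl | rfl | rfl
  · refine hk_full 0 2 (by norm_num) (by decide) (by norm_num) (discK 2) (by simp [discK])
      (by simp [discK]) p hsplit b ?_ α hα
    intro m hm
    rw [hb m hm]
    have h1 : shell 2 m = hkS 0 2 m := by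
      ext z; simp [shell, Qf, hkS, hkN]
    have h2 : Vf 2 = hkV 0 2 := by
      ext z; simp [Vf, hkV]; ring
    rw [h1, h2]
  · exact key 2 (by norm_num) (by norm_num) (by decide)
  · exact key 3 (by norm_num) (by norm_num) (by decide)
  · exact key 5 (by norm_num) (by norm_num) (by decide)
  · exact key 11 (by norm_num) (by norm_num) (by decide)
  · exact key 17 (by norm_num) (by norm_num) (by decide)
  · exact key 41 (by norm_num) (by norm_num) (by decide)
end
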